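/- Let N ≥ 1, 0 < γ < min{2,N}, p = p_F := 1 + 2/N, z ∈ ℝ^N \ {0} and 0 < T < ∞ with T ≤ |z|². There exist constants c* > 0 and C* > 0 depending only on N, p, γ (and not on T or z) with the following property: if u₀ is a nonnegative measurable function on ℝ^N satisfying u₀(x) ≤ c |z|^{γ/(p−1)} |x−z|^{−N} (log(e+|x−z|^{−1}))^{−N/2−1} χ₁(|x−z|) + C₀ for all x ∈ ℝ^N \ {z}, where 0 < c ≤ c* (1 + T^{1/2})^{−1/(p−1)} and 0 ≤ C₀ ≤ C* T^{−(2−γ)/(2(p−1))}, then the Hardy parabolic equation ∂_t u − Δu = |x|^{−γ} u^p with initial data u₀ possesses a solution on ℝ^N × [0,T). -/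

import Mathlib

open MeasureTheory Real Set

noncomputable def heatKernel (N : ℕ) (x : EuclideanSpace ℝ (Fin N)) (t : ℝ) : ℝ :=
  (4 * Real.pi * t) ^ (-(N : ℝ) / 2) * Real.exp (-‖x‖ ^ 2 / (4 * t))

/-- `u` is a (nonnegative, integral) solution of `∂_t u - Δu = |x|^{-γ} u^p`
with initial data the nonnegative measurable function `u₀`, on `ℝ^N × [0,T)`. -/
def IsSol (N : ℕ) (γ p T : ℝ) (u₀ : EuclideanSpace ℝ (Fin N) → ℝ)
    (u : EuclideanSpace ℝ (Fin N) → ℝ → ℝ) : Prop :=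
  Measurable (Function.uncurry u) ∧ (∀ x t, 0 ≤ u x t) ∧
    ∀ᵐ q : EuclideanSpace ℝ (Fin N) × ℝ,
      q.2 ∈ Set.Ioo 0 T →
        u q.1 q.2 = (∫ y, heatKernel N (q.1 - y) q.2 * u₀ y) +
          ∫ s in Set.Ioo 0 q.2, ∫ y,
            heatKernel N (q.1 - y) (q.2 - s) * ‖y‖ ^ (-γ) * u y s ^ p

open Filter Topology
open scoped ENNReal

/-! ### Calculus -/

/-- A nonnegative derivative on `(0, b)` of a function vanishing at `0⁺` integrates to the
value at `b`. -/
lemma integrableOn_Ioo_deriv_and_integral {g g' : ℝ → ℝ} {b : ℝ} (hb : 0 < b)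
    (hderiv : ∀ x ∈ Ioo 0 b, HasDerivAt g (g' x) x) (hpos : ∀ x ∈ Ioo 0 b, 0 ≤ g' x)
    (hgb : ContinuousAt g b) (hg0 : Tendsto g (𝓝[>] 0) (𝓝 0)) :
    IntegrableOn g' (Ioo 0 b) ∧ ∫ x in Ioo 0 b, g' x = g b := by
  set G := Function.update g 0 0 with hG
  have hGx : ∀ x, 0 < x → G x = g x := fun x hx => Function.update_of_ne hx.ne' _ _
  have hev : ∀ x, 0 < x → G =ᶠ[𝓝 x] g := fun x hx => by
    filter_upwards [lt_mem_nhds hx] with y hy using hGx y hy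
  have hd : ∀ x ∈ Ioo 0 b, HasDerivAt G (g' x) x := fun x hx =>
    (hderiv x hx).congr_of_eventuallyEq (hev x hx.1)
  have hcont : ContinuousOn G (Icc 0 b) := by
    intro x hx
    rcases hx.1.eq_or_lt with rfl | h0
    · have : ContinuousWithinAt G (Ioi 0) 0 := by
        rw [ContinuousWithinAt, hG, Function.update_self]
        refine hg0.congr' ?_
        filter_upwards [self_mem_nhdsWithin] with y hy using (hGx y hy).symm
      exact (continuousWithinAt_Ioi_iff_Ici.1 this).mono Icc_subset_Ici_self
    · rcases hx.2.eq_or_lt with rfl | h1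
      · exact (hgb.congr (hev _ hb).symm).continuousWithinAt
      · exact (hd x ⟨h0, h1⟩).continuousAt.continuousWithinAt
  have hint := intervalIntegral.integrableOn_deriv_of_nonneg hcont hd hpos
  refine ⟨hint.mono_set Ioo_subset_Ioc_self, ?_⟩
  rw [← integral_Ioc_eq_integral_Ioo, ← intervalIntegral.integral_of_le hb.le,
    intervalIntegral.integral_eq_sub_of_hasDerivAt_of_le hb.le hcont hd
      ((intervalIntegrable_iff_integrableOn_Ioc_of_le hb.le).2 hint), hGx b hb, hG,
    Function.update_self, sub_zero]

lemma lintegral_Ioo_deriv {g g' : ℝ → ℝ} {b : ℝ} (hb : 0 < b)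
    (hderiv : ∀ x ∈ Ioo 0 b, HasDerivAt g (g' x) x) (hpos : ∀ x ∈ Ioo 0 b, 0 ≤ g' x)
    (hgb : ContinuousAt g b) (hg0 : Tendsto g (𝓝[>] 0) (𝓝 0)) :
    ∫⁻ x in Ioo 0 b, ENNReal.ofReal (g' x) = ENNReal.ofReal (g b) := by
  obtain ⟨h1, h2⟩ := integrableOn_Ioo_deriv_and_integral hb hderiv hpos hgb hg0
  rw [← h2, ofReal_integral_eq_lintegral_ofReal h1]
  exact (ae_restrict_iff' measurableSet_Ioo).2 (ae_of_all _ hpos)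

/-- The integral of a radial function over a ball, computed from a primitive of the radial
density. -/
lemma lintegral_ball_radial {N : ℕ} (hN : 1 ≤ N) {g φ : ℝ → ℝ} {ρ : ℝ} (hρ : 0 < ρ)
    (z : EuclideanSpace ℝ (Fin N))
    (hderiv : ∀ x ∈ Ioo 0 ρ, HasDerivAt g (x ^ (N - 1) * φ x) x)
    (hφ : ∀ x, 0 ≤ x → 0 ≤ φ x)
    (hgρ : ContinuousAt g ρ) (hg0 : Tendsto g (𝓝[>] 0) (𝓝 0)) :
    ∫⁻ y in Metric.ball z ρ, ENNReal.ofReal (φ ‖y - z‖) =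
      ENNReal.ofReal (N * volume.real (Metric.ball (0 : EuclideanSpace ℝ (Fin N)) 1) * g ρ) := by
  have : Nonempty (Fin N) := ⟨⟨0, hN⟩⟩
  have hdim : Module.finrank ℝ (EuclideanSpace ℝ (Fin N)) = N := by simp
  obtain ⟨h1, h2⟩ := integrableOn_Ioo_deriv_and_integral hρ hderiv
    (fun x hx => mul_nonneg (pow_nonneg hx.1.le _) (hφ x hx.1.le)) hgρ hg0
  set ψ : ℝ → ℝ := (Iio ρ).indicator φ with hψ
  have hψ0 : ∀ x, 0 ≤ x → 0 ≤ ψ x := fun x hx => indicator_apply_nonneg fun _ => hφ x hx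
  have hind : (fun y : ℝ => y ^ (N - 1) • ψ y) =
      (Iio ρ).indicator (fun y => y ^ (N - 1) * φ y) := by
    ext y
    by_cases hy : y ∈ Iio ρ <;> simp [hψ, hy]
  have hset : Iio ρ ∩ Ioi 0 = Ioo 0 ρ := by rw [inter_comm, Ioi_inter_Iio]
  have hI : Integrable (fun x : EuclideanSpace ℝ (Fin N) => ψ ‖x‖) := by
    rw [integrable_fun_norm_addHaar, hdim, hind, IntegrableOn,
      integrable_indicator_iff measurableSet_Iio, IntegrableOn,
      Measure.restrict_restrict measurableSet_Iio, hset]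
    exact h1
  have hval : ∫ x : EuclideanSpace ℝ (Fin N), ψ ‖x‖ =
      N * volume.real (Metric.ball (0 : EuclideanSpace ℝ (Fin N)) 1) * g ρ := by
    rw [integral_fun_norm_addHaar, hdim, hind, integral_indicator measurableSet_Iio,
      Measure.restrict_restrict measurableSet_Iio, hset, h2]
    simp [mul_assoc]
  rw [← hval, ofReal_integral_eq_lintegral_ofReal hI (ae_of_all _ fun x => hψ0 _ (norm_nonneg _)),
    ← lintegral_sub_right_eq_self (fun x => ENNReal.ofReal (ψ ‖x‖)) z,
    ← lintegral_indicator measurableSet_ball]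
  refine lintegral_congr fun y => ?_
  by_cases hy : ‖y - z‖ < ρ <;> simp [hψ, indicator, dist_eq_norm, hy]

/-! ### The logarithmic weight -/

/-- The weight `log (e + 1 / r)`. -/
noncomputable def logWeight (r : ℝ) : ℝ := log (exp 1 + r⁻¹)

lemma measurable_logWeight : Measurable logWeight := by
  unfold logWeight
  fun_prop

lemma one_le_logWeight {r : ℝ} (hr : 0 ≤ r) : 1 ≤ logWeight r := by
  rw [logWeight, le_log_iff_exp_le (by positivity)]
  simpa using hr

lemma logWeight_pos {r : ℝ} (hr : 0 ≤ r) : 0 < logWeight r :=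
  zero_lt_one.trans_le (one_le_logWeight hr)

lemma logWeight_anti {ρ r : ℝ} (hρ : 0 < ρ) (h : ρ ≤ r) : logWeight r ≤ logWeight ρ := by
  have hr := hρ.trans_le h
  unfold logWeight
  gcongr

lemma logWeight_rpow_neg_le_one {r a : ℝ} (hr : 0 ≤ r) (ha : 0 ≤ a) :
    logWeight r ^ (-a) ≤ 1 :=
  rpow_le_one_of_one_le_of_nonpos (one_le_logWeight hr) (by linarith)

lemma hasDerivAt_logWeight_rpow {r : ℝ} (hr : 0 < r) (a : ℝ) :
    HasDerivAt (fun r => logWeight r ^ (1 - a))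
      ((a - 1) * (r⁻¹ * logWeight r ^ (-a)) / (1 + exp 1 * r)) r := by
  have h1 : HasDerivAt (fun r : ℝ => exp 1 + r⁻¹) (-(r ^ 2)⁻¹) r :=
    (hasDerivAt_inv hr.ne').const_add _
  have hp : exp 1 + r⁻¹ ≠ 0 := by positivity
  have h2 := (h1.log hp).rpow_const (p := 1 - a) (Or.inl (logWeight_pos hr.le).ne')
  rw [show (1 - a - 1 : ℝ) = -a by ring] at h2
  refine HasDerivAt.congr_deriv (f := fun r => logWeight r ^ (1 - a)) h2 ?_
  simp only [logWeight]
  have : 1 + exp 1 * r ≠ 0 := by positivity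
  field_simp
  ring

lemma tendsto_logWeight_rpow {a : ℝ} (ha : 1 < a) :
    Tendsto (fun r => logWeight r ^ (1 - a)) (𝓝[>] 0) (𝓝 0) := by
  have h1 : Tendsto logWeight (𝓝[>] 0) atTop :=
    tendsto_log_atTop.comp (tendsto_atTop_add_const_left _ _ tendsto_inv_nhdsGT_zero)
  have := (tendsto_rpow_neg_atTop (y := a - 1) (by linarith)).comp h1
  simpa [Function.comp_def] using this

lemma le_mul_div_of_le {X r b a : ℝ} (hX : 0 ≤ X) (hr : 0 ≤ r) (hrb : r ≤ b) (ha : 1 < a) :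
    X ≤ (1 + exp 1 * b) / (a - 1) * ((a - 1) * X / (1 + exp 1 * r)) := by
  have ha' : 0 < a - 1 := by linarith
  have hd : 0 < 1 + exp 1 * r := by positivity
  have : (1 + exp 1 * b) / (a - 1) * ((a - 1) * X / (1 + exp 1 * r)) =
      X * ((1 + exp 1 * b) / (1 + exp 1 * r)) := by
    field_simp
  rw [this]
  refine le_mul_of_one_le_right hX ?_
  rw [one_le_div hd]
  gcongr

/-- Almost-monotonicity of `r^{-n} (log (e + 1 / r))^{-a}`. -/
lemma exists_rpow_mul_logWeight_le {n a : ℝ} (hn : 0 < n) (ha : 0 < a) :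
    ∃ C : ℝ, 1 ≤ C ∧ ∀ ρ r : ℝ, 0 < ρ → ρ ≤ r →
      r ^ (-n) * logWeight r ^ (-a) ≤ C * (ρ ^ (-n) * logWeight ρ ^ (-a)) := by
  set K := max 1 (a / n)
  have hK : 1 ≤ K := le_max_left _ _
  refine ⟨K ^ a, one_le_rpow hK ha.le, fun ρ r hρ hr => ?_⟩
  have hr0 := hρ.trans_le hr
  set l := r / ρ with hl
  have hl1 : 1 ≤ l := (one_le_div hρ).2 hr
  have hl0 : 0 < l := by linarith
  have hrl : r = l * ρ := by rw [hl]; field_simp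
  have hLr := one_le_logWeight hr0.le
  have hLρ := one_le_logWeight hρ.le
  have h1 : logWeight ρ ≤ log l + logWeight r := by
    unfold logWeight
    rw [← log_mul hl0.ne' (by positivity)]
    refine log_le_log (by positivity) ?_
    have : l * r⁻¹ = ρ⁻¹ := by rw [hl]; field_simp
    rw [mul_add, this]
    gcongr
    exact le_mul_of_one_le_left (exp_pos 1).le hl1
  have h2 : 1 + log l ≤ K * l ^ (n / a) := by
    have h3 := add_one_le_exp (log l * (n / a))
    rw [exp_mul, exp_log hl0] at h3
    have h4 : log l = a / n * (log l * (n / a)) := by field_simp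
    have h5 : 0 ≤ log l * (n / a) := mul_nonneg (log_nonneg hl1) (by positivity)
    calc 1 + log l ≤ K + K * (log l * (n / a)) := by
          refine add_le_add hK ?_
          exact h4.trans_le (mul_le_mul_of_nonneg_right (le_max_right _ _) h5)
      _ ≤ _ := by rw [← mul_one_add, add_comm]; gcongr
  have h6 : logWeight ρ ≤ K * l ^ (n / a) * logWeight r := by
    refine h1.trans (le_trans ?_ (mul_le_mul_of_nonneg_right h2 (by linarith)))
    nlinarith [log_nonneg hl1]
  have h7 : logWeight ρ ^ a ≤ K ^ a * l ^ n * logWeight r ^ a := by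
    refine (rpow_le_rpow (by linarith) h6 ha.le).trans_eq ?_
    rw [mul_rpow (by positivity) (by linarith), mul_rpow (by positivity) (by positivity),
      ← rpow_mul hl0.le]
    congr 3
    field_simp
  rw [rpow_neg (by linarith), rpow_neg (by linarith), rpow_neg (by linarith),
    rpow_neg (by linarith), hrl, mul_rpow hl0.le hρ.le, ← hrl]
  have q1 : 0 < ρ ^ n := by positivity
  have q2 : 0 < l ^ n := by positivity
  have q3 : 0 < logWeight r ^ a := by positivity
  have q4 : 0 < logWeight ρ ^ a := by positivity
  rw [← mul_inv, ← mul_inv, ← div_eq_mul_inv, inv_eq_one_div, div_le_div_iff₀ (by positivity)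
    (by positivity)]
  nlinarith [mul_le_mul_of_nonneg_left h7 q1.le]

/-! ### The heat kernel -/

section HeatKernel

variable {N : ℕ}

lemma heatKernel_nonneg (x : EuclideanSpace ℝ (Fin N)) {t : ℝ} (ht : 0 < t) :
    0 ≤ heatKernel N x t := by
  unfold heatKernel
  positivity

lemma measurable_heatKernel :
    Measurable fun q : EuclideanSpace ℝ (Fin N) × ℝ => heatKernel N q.1 q.2 := by
  unfold heatKernel
  fun_prop

lemma heatKernel_le_rpow (x : EuclideanSpace ℝ (Fin N)) {t : ℝ} (ht : 0 < t) :
    heatKernel N x t ≤ t ^ (-(N : ℝ) / 2) := by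
  unfold heatKernel
  have h1 : (4 * π * t) ^ (-(N : ℝ) / 2) ≤ t ^ (-(N : ℝ) / 2) := by
    refine rpow_le_rpow_of_nonpos ht ?_ ?_
    · nlinarith [pi_gt_three]
    · have : (0 : ℝ) ≤ N := N.cast_nonneg
      linarith
  refine (mul_le_of_le_one_right (by positivity) ?_).trans h1
  rw [exp_le_one_iff]
  exact div_nonpos_of_nonpos_of_nonneg (by simp) (by positivity)

lemma rpow_mul_exp_neg_le {a τ : ℝ} (ha : 0 < a) (hτ : 0 ≤ τ) : τ ^ a * exp (-τ) ≤ a ^ a := by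
  have h1 : τ / a ≤ exp (τ / a) := by linarith [add_one_le_exp (τ / a)]
  have h2 := rpow_le_rpow (by positivity) h1 ha.le
  rw [← exp_mul, div_mul_cancel₀ _ ha.ne', div_rpow hτ ha.le,
    div_le_iff₀ (by positivity)] at h2
  rw [exp_neg, ← div_eq_mul_inv, div_le_iff₀ (exp_pos _)]
  linarith

/-- A bound for the heat kernel away from the origin, uniform in time. -/
lemma exists_heatKernel_le_norm_rpow (hN : 1 ≤ N) :
    ∃ C : ℝ, 1 ≤ C ∧ ∀ (x : EuclideanSpace ℝ (Fin N)) (t r : ℝ), 0 < t → 0 < r → r ≤ ‖x‖ →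
      heatKernel N x t ≤ C * r ^ (-(N : ℝ)) := by
  have ha : 0 < (N : ℝ) / 2 := by positivity
  refine ⟨max 1 (((N : ℝ) / 2) ^ ((N : ℝ) / 2)), le_max_left _ _, fun x t r ht hr hrx => ?_⟩
  have hτ : 0 < r ^ 2 / (4 * t) := by positivity
  have h1 := rpow_mul_exp_neg_le ha hτ.le
  have h2 : exp (-‖x‖ ^ 2 / (4 * t)) ≤ exp (-(r ^ 2 / (4 * t))) := by
    rw [← neg_div]
    gcongr
  have h3 : (4 * π * t) ^ (-(N : ℝ) / 2) ≤ r ^ (-(N : ℝ)) * (r ^ 2 / (4 * t)) ^ ((N : ℝ) / 2) := by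
    have e1 : r ^ (-(N : ℝ)) = (r ^ 2) ^ (-((N : ℝ) / 2)) := by
      rw [← rpow_natCast r 2, ← rpow_mul hr.le]
      congr 1
      push_cast
      ring
    rw [e1, div_rpow (by positivity) (by positivity), rpow_neg (by positivity), neg_div,
      rpow_neg (by positivity), ← mul_div_assoc, inv_mul_cancel₀ (by positivity), one_div]
    gcongr
    nlinarith [pi_gt_three]
  calc heatKernel N x t
      ≤ r ^ (-(N : ℝ)) * (r ^ 2 / (4 * t)) ^ ((N : ℝ) / 2) * exp (-(r ^ 2 / (4 * t))) := by
        unfold heatKernel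
        gcongr
    _ ≤ r ^ (-(N : ℝ)) * (((N : ℝ) / 2) ^ ((N : ℝ) / 2)) := by
        rw [mul_assoc]
        gcongr
    _ ≤ _ := by
        rw [mul_comm]
        gcongr
        exact le_max_right _ _

lemma lintegral_heatKernel (x : EuclideanSpace ℝ (Fin N)) {t : ℝ} (ht : 0 < t) :
    ∫⁻ y, ENNReal.ofReal (heatKernel N (x - y) t) = 1 := by
  rw [lintegral_sub_left_eq_self (fun y => ENNReal.ofReal (heatKernel N y t)) x]
  have hb : 0 < 1 / (4 * t) := by positivity
  have h0 : ∀ y : EuclideanSpace ℝ (Fin N), heatKernel N y t =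
      (4 * π * t) ^ (-(N : ℝ) / 2) * exp (-(1 / (4 * t)) * ‖y‖ ^ 2) := fun y => by
    unfold heatKernel
    congr 2
    ring
  have h1 := GaussianFourier.integral_rexp_neg_mul_sq_norm (V := EuclideanSpace ℝ (Fin N)) hb
  have hpos : 0 < (π / (1 / (4 * t))) ^ ((N : ℝ) / 2) := by positivity
  simp only [finrank_euclideanSpace, Fintype.card_fin] at h1
  have hint : Integrable fun y : EuclideanSpace ℝ (Fin N) => exp (-(1 / (4 * t)) * ‖y‖ ^ 2) :=
    not_imp_comm.1 integral_undef (by rw [h1]; exact hpos.ne')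
  simp only [h0]
  rw [← ofReal_integral_eq_lintegral_ofReal (hint.const_mul _) (ae_of_all _ fun y => by positivity),
    integral_const_mul, h1, neg_div, rpow_neg (by positivity)]
  rw [show π / (1 / (4 * t)) = 4 * π * t by field_simp, inv_mul_cancel₀ (by positivity)]
  simp

lemma heatKernel_mul_heatKernel (x y w : EuclideanSpace ℝ (Fin N)) {s t : ℝ} (hs : 0 < s)
    (ht : 0 < t) :
    heatKernel N (x - y) t * heatKernel N (y - w) s =
      heatKernel N (x - w) (t + s) *
        heatKernel N ((s / (t + s)) • x + (t / (t + s)) • w - y) (t * s / (t + s)) := by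
  have hts : 0 < t + s := by positivity
  unfold heatKernel
  have e1 : (4 * π * t) ^ (-(N : ℝ) / 2) * (4 * π * s) ^ (-(N : ℝ) / 2) =
      (4 * π * (t + s)) ^ (-(N : ℝ) / 2) * (4 * π * (t * s / (t + s))) ^ (-(N : ℝ) / 2) := by
    rw [← mul_rpow (by positivity) (by positivity), ← mul_rpow (by positivity) (by positivity)]
    congr 1
    field_simp
  have e2 : -‖x - y‖ ^ 2 / (4 * t) + -‖y - w‖ ^ 2 / (4 * s) =
      -‖x - w‖ ^ 2 / (4 * (t + s)) +
        -‖(s / (t + s)) • x + (t / (t + s)) • w - y‖ ^ 2 / (4 * (t * s / (t + s))) := by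
    obtain ⟨a, rfl⟩ : ∃ a, x = a + y := ⟨x - y, by simp⟩
    obtain ⟨b, rfl⟩ : ∃ b, w = y - b := ⟨y - w, by simp⟩
    have h1 : a + y - (y - b) = a + b := by abel
    have h2 : (s / (t + s)) • (a + y) + (t / (t + s)) • (y - b) - y =
        (s / (t + s)) • a - (t / (t + s)) • b := by
      have : (s / (t + s)) • y + (t / (t + s)) • y = y := by
        rw [← add_smul, ← add_div, add_comm s t, div_self hts.ne', one_smul]
      rw [smul_add, smul_sub]
      nth_rewrite 3 [← this]
      abel
    rw [h1, h2, add_sub_cancel_right, sub_sub_cancel, norm_add_sq_real, norm_sub_sq_real,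
      norm_smul, norm_smul, real_inner_smul_left, real_inner_smul_right,
      Real.norm_of_nonneg (by positivity), Real.norm_of_nonneg (by positivity)]
    field_simp
    ring
  calc _ = ((4 * π * t) ^ (-(N : ℝ) / 2) * (4 * π * s) ^ (-(N : ℝ) / 2)) *
        exp (-‖x - y‖ ^ 2 / (4 * t) + -‖y - w‖ ^ 2 / (4 * s)) := by rw [exp_add]; ring
    _ = _ := by rw [e1, e2, exp_add]; ring

/-- The heat semigroup acting on `[0, ∞]`-valued functions. -/
noncomputable def heatFlow (N : ℕ) (t : ℝ) (f : EuclideanSpace ℝ (Fin N) → ℝ≥0∞)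
    (x : EuclideanSpace ℝ (Fin N)) : ℝ≥0∞ :=
  ∫⁻ y, ENNReal.ofReal (heatKernel N (x - y) t) * f y

lemma measurable_heatKernel_sub (x : EuclideanSpace ℝ (Fin N)) (t : ℝ) :
    Measurable fun y => ENNReal.ofReal (heatKernel N (x - y) t) :=
  (measurable_heatKernel.comp ((measurable_const.sub measurable_id).prodMk
    (measurable_const (a := t)))).ennreal_ofReal

lemma heatFlow_mono_ae {f g : EuclideanSpace ℝ (Fin N) → ℝ≥0∞} (h : ∀ᵐ y, f y ≤ g y) (t : ℝ)
    (x : EuclideanSpace ℝ (Fin N)) : heatFlow N t f x ≤ heatFlow N t g x := by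
  refine lintegral_mono_ae ?_
  filter_upwards [h] with y hy
  gcongr

lemma heatFlow_mono {f g : EuclideanSpace ℝ (Fin N) → ℝ≥0∞} (h : ∀ y, f y ≤ g y) (t : ℝ)
    (x : EuclideanSpace ℝ (Fin N)) : heatFlow N t f x ≤ heatFlow N t g x :=
  heatFlow_mono_ae (ae_of_all _ h) t x

lemma heatFlow_add {f g : EuclideanSpace ℝ (Fin N) → ℝ≥0∞} (hf : Measurable f) (t : ℝ)
    (x : EuclideanSpace ℝ (Fin N)) :
    heatFlow N t (fun y => f y + g y) x = heatFlow N t f x + heatFlow N t g x := by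
  simp only [heatFlow, mul_add]
  exact lintegral_add_left ((measurable_heatKernel_sub x t).mul hf) _

lemma heatFlow_const_mul {f : EuclideanSpace ℝ (Fin N) → ℝ≥0∞} (c : ℝ≥0∞) (hf : Measurable f)
    (t : ℝ) (x : EuclideanSpace ℝ (Fin N)) :
    heatFlow N t (fun y => c * f y) x = c * heatFlow N t f x := by
  simp only [heatFlow, mul_left_comm _ c]
  exact lintegral_const_mul _ ((measurable_heatKernel_sub x t).mul hf)

lemma heatFlow_const (c : ℝ≥0∞) {t : ℝ} (ht : 0 < t) (x : EuclideanSpace ℝ (Fin N)) :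
    heatFlow N t (fun _ => c) x = c := by
  rw [heatFlow, lintegral_mul_const _ (measurable_heatKernel_sub x t), lintegral_heatKernel x ht,
    one_mul]

lemma heatFlow_le_const {f : EuclideanSpace ℝ (Fin N) → ℝ≥0∞} {c : ℝ≥0∞} (h : ∀ y, f y ≤ c)
    {t : ℝ} (ht : 0 < t) (x : EuclideanSpace ℝ (Fin N)) : heatFlow N t f x ≤ c :=
  (heatFlow_mono h t x).trans_eq (heatFlow_const c ht x)

lemma measurable_heatFlow {f : EuclideanSpace ℝ (Fin N) → ℝ≥0∞} (hf : Measurable f) :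
    Measurable fun q : EuclideanSpace ℝ (Fin N) × ℝ => heatFlow N q.2 f q.1 := by
  unfold heatFlow
  refine Measurable.lintegral_prod_right' (f := fun r : (EuclideanSpace ℝ (Fin N) × ℝ) ×
    EuclideanSpace ℝ (Fin N) => ENNReal.ofReal (heatKernel N (r.1.1 - r.2) r.1.2) * f r.2) ?_
  refine Measurable.mul ?_ (hf.comp measurable_snd)
  exact (measurable_heatKernel.comp (f := fun r : (EuclideanSpace ℝ (Fin N) × ℝ) ×
    EuclideanSpace ℝ (Fin N) => (r.1.1 - r.2, r.1.2)) (by fun_prop)).ennreal_ofReal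

lemma heatFlow_heatFlow {f : EuclideanSpace ℝ (Fin N) → ℝ≥0∞} (hf : Measurable f) {s t : ℝ}
    (hs : 0 < s) (ht : 0 < t) (x : EuclideanSpace ℝ (Fin N)) :
    heatFlow N t (heatFlow N s f) x = heatFlow N (t + s) f x := by
  have hst : 0 < t * s / (t + s) := by positivity
  have hm : Measurable fun r : EuclideanSpace ℝ (Fin N) × EuclideanSpace ℝ (Fin N) =>
      ENNReal.ofReal (heatKernel N (r.1 - r.2) s) * f r.2 := by
    refine Measurable.mul ?_ (hf.comp measurable_snd)
    exact (measurable_heatKernel.comp (f := fun r : EuclideanSpace ℝ (Fin N) ×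
      EuclideanSpace ℝ (Fin N) => (r.1 - r.2, s)) (by fun_prop)).ennreal_ofReal
  calc heatFlow N t (heatFlow N s f) x
      = ∫⁻ y, ∫⁻ w, ENNReal.ofReal (heatKernel N (x - y) t) *
          (ENNReal.ofReal (heatKernel N (y - w) s) * f w) := by
        refine lintegral_congr fun y => ?_
        exact (lintegral_const_mul _ ((measurable_heatKernel_sub y s).mul hf)).symm
    _ = ∫⁻ w, ∫⁻ y, ENNReal.ofReal (heatKernel N (x - y) t) *
          (ENNReal.ofReal (heatKernel N (y - w) s) * f w) :=
        lintegral_lintegral_swap (Measurable.aemeasurable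
          (((measurable_heatKernel_sub x t).comp measurable_fst).mul hm))
    _ = heatFlow N (t + s) f x := by
        refine lintegral_congr fun w => ?_
        have : ∀ y, ENNReal.ofReal (heatKernel N (x - y) t) *
            (ENNReal.ofReal (heatKernel N (y - w) s) * f w) =
            (ENNReal.ofReal (heatKernel N (x - w) (t + s)) * f w) *
              ENNReal.ofReal (heatKernel N ((s / (t + s)) • x + (t / (t + s)) • w - y)
                (t * s / (t + s))) := fun y => by
          rw [← mul_assoc, ← ENNReal.ofReal_mul (heatKernel_nonneg _ ht),
            heatKernel_mul_heatKernel x y w hs ht,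
            ENNReal.ofReal_mul (heatKernel_nonneg _ (by positivity)), mul_right_comm]
        simp only [this]
        rw [lintegral_const_mul _ (measurable_heatKernel_sub _ _), lintegral_heatKernel _ hst,
          mul_one]

/-- Splitting the heat flow into the contributions from a ball and from its complement. -/
lemma heatFlow_le_of_ball {f : EuclideanSpace ℝ (Fin N) → ℝ≥0∞} {x z : EuclideanSpace ℝ (Fin N)}
    {t ρ A : ℝ} {M S : ℝ≥0∞} (ht : 0 < t)
    (hA : ∀ y ∈ Metric.ball z ρ, heatKernel N (x - y) t ≤ A)
    (hM : ∫⁻ y in Metric.ball z ρ, f y ≤ M) (hS : ∀ y ∉ Metric.ball z ρ, f y ≤ S) :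
    heatFlow N t f x ≤ ENNReal.ofReal A * M + S := by
  unfold heatFlow
  rw [← lintegral_add_compl _ (Metric.isOpen_ball (x := z) (ε := ρ)).measurableSet]
  gcongr
  · calc _ ≤ ∫⁻ y in Metric.ball z ρ, ENNReal.ofReal A * f y := by
          refine setLIntegral_mono' measurableSet_ball fun y hy => ?_
          gcongr
          exact hA y hy
      _ ≤ _ := by
          rw [lintegral_const_mul' _ _ ENNReal.ofReal_ne_top]
          gcongr
  · calc _ ≤ ∫⁻ y in (Metric.ball z ρ)ᶜ, ENNReal.ofReal (heatKernel N (x - y) t) * S := by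
          refine setLIntegral_mono' measurableSet_ball.compl fun y hy => ?_
          gcongr
          exact hS y hy
      _ ≤ ∫⁻ y, ENNReal.ofReal (heatKernel N (x - y) t) * S := setLIntegral_le_lintegral _ _
      _ = S := heatFlow_const S ht x

end HeatKernel

/-! ### Existence of solutions below supersolutions -/

section Existence

variable {N : ℕ} {γ p : ℝ}

/-- The Duhamel integral of `|x|^{-γ} v^p`. -/
noncomputable def duhamel (N : ℕ) (γ p : ℝ) (v : EuclideanSpace ℝ (Fin N) → ℝ → ℝ≥0∞)
    (x : EuclideanSpace ℝ (Fin N)) (t : ℝ) : ℝ≥0∞ :=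
  ∫⁻ s in Ioo 0 t, heatFlow N (t - s) (fun y => ENNReal.ofReal (‖y‖ ^ (-γ)) * v y s ^ p) x

lemma measurable_potential (γ : ℝ) :
    Measurable fun y : EuclideanSpace ℝ (Fin N) => ENNReal.ofReal (‖y‖ ^ (-γ)) := by
  fun_prop

lemma measurable_heatFlow_source {v : EuclideanSpace ℝ (Fin N) → ℝ → ℝ≥0∞}
    (hv : Measurable (Function.uncurry v)) :
    Measurable fun r : (EuclideanSpace ℝ (Fin N) × ℝ) × ℝ =>
      heatFlow N (r.1.2 - r.2) (fun y => ENNReal.ofReal (‖y‖ ^ (-γ)) * v y r.2 ^ p) r.1.1 := by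
  unfold heatFlow
  refine Measurable.lintegral_prod_right' (f := fun r : ((EuclideanSpace ℝ (Fin N) × ℝ) × ℝ) ×
    EuclideanSpace ℝ (Fin N) => ENNReal.ofReal (heatKernel N (r.1.1.1 - r.2) (r.1.1.2 - r.1.2)) *
      (ENNReal.ofReal (‖r.2‖ ^ (-γ)) * v r.2 r.1.2 ^ p)) ?_
  refine Measurable.mul ?_ (((measurable_potential γ).comp measurable_snd).mul ?_)
  · exact (measurable_heatKernel.comp (f := fun r : ((EuclideanSpace ℝ (Fin N) × ℝ) × ℝ) ×
      EuclideanSpace ℝ (Fin N) => (r.1.1.1 - r.2, r.1.1.2 - r.1.2)) (by fun_prop)).ennreal_ofReal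
  · exact (hv.comp (f := fun r : ((EuclideanSpace ℝ (Fin N) × ℝ) × ℝ) ×
      EuclideanSpace ℝ (Fin N) => (r.2, r.1.2)) (by fun_prop)).pow_const p

lemma measurable_duhamel {v : EuclideanSpace ℝ (Fin N) → ℝ → ℝ≥0∞}
    (hv : Measurable (Function.uncurry v)) :
    Measurable fun q : EuclideanSpace ℝ (Fin N) × ℝ => duhamel N γ p v q.1 q.2 := by
  unfold duhamel
  simp only [← lintegral_indicator measurableSet_Ioo]
  refine Measurable.lintegral_prod_right' (f := fun r : (EuclideanSpace ℝ (Fin N) × ℝ) × ℝ =>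
    (Ioo 0 r.1.2).indicator (fun s => heatFlow N (r.1.2 - s)
      (fun y => ENNReal.ofReal (‖y‖ ^ (-γ)) * v y s ^ p) r.1.1) r.2) ?_
  have hS : MeasurableSet {r : (EuclideanSpace ℝ (Fin N) × ℝ) × ℝ | r.2 ∈ Ioo 0 r.1.2} :=
    (measurableSet_lt measurable_const measurable_snd).inter
      (measurableSet_lt measurable_snd (measurable_snd.comp measurable_fst))
  convert (measurable_heatFlow_source (γ := γ) (p := p) hv).indicator hS using 1
  ext r
  simp [indicator]

lemma duhamel_mono (hp : 0 ≤ p) {v w : EuclideanSpace ℝ (Fin N) → ℝ → ℝ≥0∞} {t : ℝ}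
    (h : ∀ y, ∀ s ∈ Ioo 0 t, v y s ≤ w y s) (x : EuclideanSpace ℝ (Fin N)) :
    duhamel N γ p v x t ≤ duhamel N γ p w x t := by
  refine setLIntegral_mono' measurableSet_Ioo fun s hs => heatFlow_mono (fun y => ?_) _ _
  gcongr
  exact h y s hs

lemma duhamel_iSup (hp : 0 < p) {v : ℕ → EuclideanSpace ℝ (Fin N) → ℝ → ℝ≥0∞}
    (hv : ∀ n, Measurable (Function.uncurry (v n))) (hmono : Monotone v)
    (x : EuclideanSpace ℝ (Fin N)) (t : ℝ) :
    duhamel N γ p (fun y s => ⨆ n, v n y s) x t = ⨆ n, duhamel N γ p (v n) x t := by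
  have hle : ∀ {n m}, n ≤ m → ∀ y s, v n y s ≤ v m y s := fun h y s => hmono h y s
  have hpow : ∀ y s, (⨆ n, v n y s) ^ p = ⨆ n, v n y s ^ p := fun y s =>
    (ENNReal.orderIsoRpow p hp).map_iSup fun n => v n y s
  unfold duhamel
  rw [← lintegral_iSup]
  · refine lintegral_congr fun s => ?_
    unfold heatFlow
    simp only [hpow, ENNReal.mul_iSup]
    refine lintegral_iSup (fun n => ?_) fun n m hnm y => ?_
    · exact (measurable_heatKernel_sub x _).mul
        ((measurable_potential γ).mul (((hv n).comp (f := fun y => (y, s))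
          (by fun_prop)).pow_const p))
    · have := hle hnm y s
      dsimp only
      gcongr
  · exact fun n => (measurable_heatFlow_source (γ := γ) (p := p) (hv n)).comp
      (f := fun s => ((x, t), s)) (by fun_prop)
  · intro n m hnm s
    refine heatFlow_mono (fun y => ?_) _ _
    have := hle hnm y s
    gcongr

/-- The Picard iterates starting from `0`. -/
noncomputable def picard (N : ℕ) (γ p : ℝ) (f : EuclideanSpace ℝ (Fin N) → ℝ≥0∞) :
    ℕ → EuclideanSpace ℝ (Fin N) → ℝ → ℝ≥0∞
  | 0 => fun _ _ => 0
  | n + 1 => fun x t => heatFlow N t f x + duhamel N γ p (picard N γ p f n) x t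

lemma measurable_picard {f : EuclideanSpace ℝ (Fin N) → ℝ≥0∞} (hf : Measurable f) (n : ℕ) :
    Measurable (Function.uncurry (picard N γ p f n)) := by
  induction n with
  | zero => exact measurable_const
  | succ n ih => exact (measurable_heatFlow hf).add (measurable_duhamel ih)

lemma picard_monotone (hp : 0 ≤ p) (f : EuclideanSpace ℝ (Fin N) → ℝ≥0∞) :
    Monotone (picard N γ p f) := by
  refine monotone_nat_of_le_succ fun n => ?_
  induction n with
  | zero => exact fun x t => zero_le
  | succ n ih =>
    intro x t
    simp only [picard]
    gcongr
    exact duhamel_mono hp (fun y s _ => ih y s) x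

lemma picard_le (hp : 0 ≤ p) {f : EuclideanSpace ℝ (Fin N) → ℝ≥0∞} {T : ℝ}
    {w : EuclideanSpace ℝ (Fin N) → ℝ → ℝ≥0∞}
    (hw : ∀ x, ∀ t ∈ Ioo 0 T, heatFlow N t f x + duhamel N γ p w x t ≤ w x t) (n : ℕ) :
    ∀ x, ∀ t ∈ Ioo 0 T, picard N γ p f n x t ≤ w x t := by
  induction n with
  | zero => exact fun x t _ => zero_le
  | succ n ih =>
    intro x t ht
    refine le_trans ?_ (hw x t ht)
    simp only [picard]
    gcongr
    exact duhamel_mono hp (fun y s hs => ih y s ⟨hs.1, hs.2.trans ht.2⟩) x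

/-- A finite supersolution yields a solution. -/
theorem exists_isSol_of_supersolution (hp : 0 < p) {T : ℝ}
    {u₀ : EuclideanSpace ℝ (Fin N) → ℝ} (hu₀ : Measurable u₀) (hu₀' : ∀ x, 0 ≤ u₀ x)
    {w : EuclideanSpace ℝ (Fin N) → ℝ → ℝ≥0∞} (hwfin : ∀ x, ∀ t ∈ Ioo 0 T, w x t < ∞)
    (hw : ∀ x, ∀ t ∈ Ioo 0 T,
      heatFlow N t (fun y => ENNReal.ofReal (u₀ y)) x + duhamel N γ p w x t ≤ w x t) :
    ∃ u, IsSol N γ p T u₀ u := by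
  set f : EuclideanSpace ℝ (Fin N) → ℝ≥0∞ := fun y => ENNReal.ofReal (u₀ y) with hf
  have hfm : Measurable f := hu₀.ennreal_ofReal
  set v : EuclideanSpace ℝ (Fin N) → ℝ → ℝ≥0∞ := fun x t => ⨆ n, picard N γ p f n x t with hv
  have hvm : Measurable (Function.uncurry v) :=
    Measurable.iSup fun n => measurable_picard (γ := γ) (p := p) hfm n
  have hvfin : ∀ x, ∀ t ∈ Ioo 0 T, v x t < ∞ := fun x t ht =>
    (iSup_le fun n => picard_le hp.le hw n x t ht).trans_lt (hwfin x t ht)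
  have hfix : ∀ x t, v x t = heatFlow N t f x + duhamel N γ p v x t := by
    intro x t
    rw [duhamel_iSup hp (measurable_picard hfm) (picard_monotone hp.le f), ENNReal.add_iSup]
    refine le_antisymm (iSup_le fun n => ?_) (iSup_le fun n => ?_)
    · exact (picard_monotone hp.le f n.le_succ x t).trans
        (le_iSup (fun n => heatFlow N t f x + duhamel N γ p (picard N γ p f n) x t) n)
    · exact le_iSup (fun n => picard N γ p f n x t) (n + 1)
  refine ⟨fun x t => (Ioo 0 T).indicator (fun t => (v x t).toReal) t, ?_, ?_, ae_of_all _ ?_⟩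
  · convert hvm.ennreal_toReal.indicator (measurable_snd measurableSet_Ioo :
      MeasurableSet (Prod.snd ⁻¹' Ioo 0 T)) using 1
    ext q
    simp [indicator, Function.uncurry]
  · exact fun x t => indicator_nonneg (fun _ _ => ENNReal.toReal_nonneg) _
  rintro ⟨x, t⟩ ht
  simp only at ht ⊢
  have hsum : heatFlow N t f x + duhamel N γ p v x t < ∞ := hfix x t ▸ hvfin x t ht
  have hD := (ENNReal.add_lt_top.1 hsum).2
  have hS := measurable_heatFlow_source (γ := γ) (p := p) hvm
  rw [indicator_of_mem ht, hfix, ENNReal.toReal_add (ENNReal.add_lt_top.1 hsum).1.ne hD.ne]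
  congr 1
  · rw [integral_eq_lintegral_of_nonneg_ae
      (ae_of_all _ fun y => mul_nonneg (heatKernel_nonneg _ ht.1) (hu₀' y))]
    · unfold heatFlow
      simp only [ENNReal.ofReal_mul (heatKernel_nonneg _ ht.1), hf]
    · exact ((measurable_heatKernel.comp (f := fun y => (x - y, t)) (by fun_prop)).mul
        hu₀).aestronglyMeasurable
  · have hSx : Measurable fun s => heatFlow N (t - s)
        (fun y => ENNReal.ofReal (‖y‖ ^ (-γ)) * v y s ^ p) x :=
      hS.comp (f := fun s => ((x, t), s)) (by fun_prop)
    rw [duhamel, ← integral_toReal hSx.aemeasurable (ae_lt_top hSx hD.ne)]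
    refine setIntegral_congr_fun measurableSet_Ioo fun s hs => ?_
    have hsT : s ∈ Ioo 0 T := ⟨hs.1, hs.2.trans ht.2⟩
    have hts : 0 < t - s := sub_pos.2 hs.2
    simp only [indicator_of_mem hsT]
    have hvs : Measurable fun y => v y s := hvm.comp (f := fun y => (y, s)) (by fun_prop)
    rw [integral_eq_lintegral_of_nonneg_ae]
    · unfold heatFlow
      congr 1
      refine lintegral_congr fun y => ?_
      rw [ENNReal.ofReal_mul (mul_nonneg (heatKernel_nonneg _ hts) (by positivity)),
        ENNReal.ofReal_mul (heatKernel_nonneg _ hts),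
        ← ENNReal.ofReal_rpow_of_nonneg ENNReal.toReal_nonneg hp.le,
        ENNReal.ofReal_toReal (hvfin y s hsT).ne, mul_assoc]
    · exact ae_of_all _ fun y =>
        mul_nonneg (mul_nonneg (heatKernel_nonneg _ hts) (by positivity)) (by positivity)
    · refine Measurable.aestronglyMeasurable ?_
      refine Measurable.mul (Measurable.mul ?_ (by fun_prop))
        (hvs.ennreal_toReal.pow_const p)
      exact measurable_heatKernel.comp (f := fun y => (x - y, t - s)) (by fun_prop)

end Existence

/-! ### Estimates for the potential and for the logarithmic profiles -/

section Estimates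

variable {N : ℕ}

lemma tendsto_rpow_nhdsGT_zero {a : ℝ} (ha : 0 < a) :
    Tendsto (fun r : ℝ => r ^ a) (𝓝[>] 0) (𝓝 0) := by
  have := (continuousAt_rpow_const (0 : ℝ) a (Or.inr ha.le)).tendsto
  rw [zero_rpow ha.ne'] at this
  exact this.mono_left nhdsWithin_le_nhds

lemma lintegral_ball_norm_rpow (hN : 1 ≤ N) {γ : ℝ} (hγ : γ < N) {ρ : ℝ} (hρ : 0 < ρ) :
    ∫⁻ y in Metric.ball (0 : EuclideanSpace ℝ (Fin N)) ρ, ENNReal.ofReal (‖y‖ ^ (-γ)) =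
      ENNReal.ofReal (N * volume.real (Metric.ball (0 : EuclideanSpace ℝ (Fin N)) 1) *
        (ρ ^ ((N : ℝ) - γ) / (N - γ))) := by
  have hNγ : 0 < (N : ℝ) - γ := by linarith
  have := lintegral_ball_radial hN (g := fun r => r ^ ((N : ℝ) - γ) / (N - γ))
    (φ := fun r => r ^ (-γ)) hρ (0 : EuclideanSpace ℝ (Fin N)) ?_ ?_ ?_ ?_
  · simpa using this
  · intro r hr
    refine ((hasDerivAt_rpow_const (Or.inl hr.1.ne')).div_const _).congr_deriv ?_
    rw [mul_div_cancel_left₀ _ hNγ.ne', ← rpow_natCast, ← rpow_add hr.1]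
    push_cast [Nat.cast_sub hN]
    congr 1
    ring
  · exact fun r hr => rpow_nonneg hr _
  · exact (continuousAt_rpow_const _ _ (Or.inl hρ.ne')).div_const _
  · simpa using (tendsto_rpow_nhdsGT_zero hNγ).div_const ((N : ℝ) - γ)

lemma sqrt_rpow {t : ℝ} (ht : 0 ≤ t) (a : ℝ) : √t ^ a = t ^ (a / 2) := by
  rw [sqrt_eq_rpow, ← rpow_mul ht]
  congr 1
  ring

lemma exists_heatFlow_potential_le (hN : 1 ≤ N) {γ : ℝ} (hγ0 : 0 < γ) (hγ : γ < N) :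
    ∃ C : ℝ, 0 < C ∧ ∀ (t : ℝ) (x : EuclideanSpace ℝ (Fin N)), 0 < t →
      heatFlow N t (fun y => ENNReal.ofReal (‖y‖ ^ (-γ))) x ≤
        ENNReal.ofReal (C * t ^ (-γ / 2)) := by
  have hNγ : 0 < (N : ℝ) - γ := by linarith
  set ω := (N : ℝ) * volume.real (Metric.ball (0 : EuclideanSpace ℝ (Fin N)) 1) with hω
  have hω0 : 0 ≤ ω := by positivity
  refine ⟨ω / (N - γ) + 1, by positivity, fun t x ht => ?_⟩
  have hsq : 0 < √t := sqrt_pos.2 ht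
  refine (heatFlow_le_of_ball (z := 0) (ρ := √t) (S := ENNReal.ofReal (√t ^ (-γ))) ht
    (fun y _ => heatKernel_le_rpow (x - y) ht)
    (lintegral_ball_norm_rpow hN hγ hsq).le fun y hy => ?_).trans_eq ?_
  · refine ENNReal.ofReal_le_ofReal (rpow_le_rpow_of_nonpos hsq ?_ (by linarith))
    simpa using hy
  · rw [← ENNReal.ofReal_mul (by positivity), ← ENNReal.ofReal_add (by positivity) (by positivity),
      sqrt_rpow ht.le, sqrt_rpow ht.le, add_mul, one_mul]
    congr 2
    rw [← hω, show -γ / 2 = -(N : ℝ) / 2 + (N - γ) / 2 by ring, rpow_add ht]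
    ring

/-- The Duhamel integral of the potential itself. -/
lemma exists_lintegral_heatFlow_potential_le (hN : 1 ≤ N) {γ : ℝ} (hγ0 : 0 < γ) (hγ : γ < N)
    (hγ2 : γ < 2) :
    ∃ C : ℝ, 0 < C ∧ ∀ (t : ℝ) (x : EuclideanSpace ℝ (Fin N)), 0 < t →
      ∫⁻ s in Ioo 0 t, heatFlow N (t - s) (fun y => ENNReal.ofReal (‖y‖ ^ (-γ))) x ≤
        ENNReal.ofReal (C * t ^ (1 - γ / 2)) := by
  obtain ⟨C, hC, h⟩ := exists_heatFlow_potential_le hN hγ0 hγ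
  have hκ : 0 < 1 - γ / 2 := by linarith
  refine ⟨C / (1 - γ / 2), by positivity, fun t x ht => ?_⟩
  have key := lintegral_Ioo_deriv ht
    (g := fun s => C / (1 - γ / 2) * (t ^ (1 - γ / 2) - (t - s) ^ (1 - γ / 2)))
    (g' := fun s => C * (t - s) ^ (-γ / 2)) ?_ ?_ ?_ ?_
  · simp only [sub_self, zero_rpow hκ.ne', sub_zero] at key
    rw [← key]
    exact setLIntegral_mono' measurableSet_Ioo fun s hs => h _ _ (sub_pos.2 hs.2)
  · intro s hs
    have h1 : HasDerivAt (fun s : ℝ => t - s) (-1) s := (hasDerivAt_id s).const_sub t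
    have h2 := h1.rpow_const (p := 1 - γ / 2) (Or.inl (sub_pos.2 hs.2).ne')
    refine ((h2.const_sub (t ^ (1 - γ / 2))).const_mul (C / (1 - γ / 2))).congr_deriv ?_
    rw [show 1 - γ / 2 - 1 = -γ / 2 by ring]
    have : 2 - γ ≠ 0 := by linarith
    field_simp
  · intro s hs
    have := sub_pos.2 hs.2
    positivity
  · have : ContinuousAt (fun s : ℝ => (t - s) ^ (1 - γ / 2)) t :=
      (continuousAt_const.sub continuousAt_id).rpow_const (Or.inr hκ.le)
    fun_prop
  · have h1 : ContinuousAt (fun s : ℝ => (t - s) ^ (1 - γ / 2)) 0 :=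
      (continuousAt_const.sub continuousAt_id).rpow_const (Or.inr hκ.le)
    have : ContinuousAt
        (fun s => C / (1 - γ / 2) * (t ^ (1 - γ / 2) - (t - s) ^ (1 - γ / 2))) 0 := by fun_prop
    simpa using this.tendsto.mono_left (nhdsWithin_le_nhds (s := Ioi 0))

lemma exists_lintegral_logWeight_sqrt_le {a : ℝ} (ha : 1 < a) :
    ∃ C : ℝ, 0 < C ∧ ∀ t : ℝ, 0 < t →
      ∫⁻ s in Ioo 0 t, ENNReal.ofReal (s⁻¹ * logWeight √s ^ (-a)) ≤
        ENNReal.ofReal (C * (1 + √t) * logWeight √t ^ (1 - a)) := by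
  have ha' : 0 < a - 1 := by linarith
  refine ⟨2 * exp 1 / (a - 1), by positivity, fun t ht => ?_⟩
  have hL : 0 < logWeight √t := logWeight_pos (sqrt_nonneg _)
  set c := 2 * ((1 + exp 1 * √t) / (a - 1)) with hc
  have key := lintegral_Ioo_deriv ht (g := fun s => c * logWeight √s ^ (1 - a))
    (g' := fun s => c * ((a - 1) * ((√s)⁻¹ * logWeight √s ^ (-a)) / (1 + exp 1 * √s) *
      (1 / (2 * √s)))) ?_ ?_ ?_ ?_
  · calc _ ≤ _ := setLIntegral_mono' measurableSet_Ioo fun s hs => ?_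
      _ = _ := key
      _ ≤ _ := ?_
    · refine ENNReal.ofReal_le_ofReal ?_
      have hs0 : 0 < √s := sqrt_pos.2 hs.1
      have hLs : 0 < logWeight √s := logWeight_pos hs0.le
      refine (le_mul_div_of_le (by have := hs.1; positivity) hs0.le
        (sqrt_le_sqrt hs.2.le) ha).trans_eq ?_
      have : s⁻¹ = (√s)⁻¹ * (√s)⁻¹ := by rw [← mul_inv, mul_self_sqrt hs.1.le]
      rw [this, hc]
      field_simp
    · refine ENNReal.ofReal_le_ofReal (mul_le_mul_of_nonneg_right ?_ (by positivity))
      rw [hc, mul_div_assoc', div_mul_eq_mul_div, mul_assoc]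
      gcongr
      nlinarith [add_one_le_exp (1 : ℝ), sqrt_nonneg t]
  · intro s hs
    exact ((hasDerivAt_logWeight_rpow (sqrt_pos.2 hs.1) a).comp s
      (hasDerivAt_sqrt hs.1.ne')).const_mul c
  · intro s hs
    have : 0 < logWeight √s := logWeight_pos (sqrt_nonneg _)
    positivity
  · exact ((hasDerivAt_logWeight_rpow (sqrt_pos.2 ht) a).comp t
      (hasDerivAt_sqrt ht.ne')).continuousAt.const_mul c
  · have h1 : Tendsto (fun s => √s) (𝓝[>] 0) (𝓝[>] 0) := by
      refine tendsto_nhdsWithin_iff.2 ⟨?_, ?_⟩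
      · have := (continuous_sqrt.tendsto 0).mono_left (nhdsWithin_le_nhds (s := Ioi 0))
        simpa using this
      · filter_upwards [self_mem_nhdsWithin] with s hs using sqrt_pos.2 hs
    simpa using ((tendsto_logWeight_rpow ha).comp h1).const_mul c

/-- The profile `|y - z|^{-N} (log (e + |y - z|⁻¹))^{-a}`, cut off outside the unit ball. -/
noncomputable def logProfile (N : ℕ) (a : ℝ) (z y : EuclideanSpace ℝ (Fin N)) : ℝ :=
  ‖y - z‖ ^ (-(N : ℝ)) * logWeight ‖y - z‖ ^ (-a) *
    indicator (Icc (0 : ℝ) 1) (fun _ => (1 : ℝ)) ‖y - z‖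

lemma measurable_logProfile (a : ℝ) (z : EuclideanSpace ℝ (Fin N)) :
    Measurable (logProfile N a z) := by
  have h1 : Measurable fun y : EuclideanSpace ℝ (Fin N) => ‖y - z‖ := by fun_prop
  exact ((h1.pow_const _).mul ((measurable_logWeight.comp h1).pow_const _)).mul
    ((measurable_const.indicator measurableSet_Icc).comp h1)

lemma logProfile_nonneg (a : ℝ) (z y : EuclideanSpace ℝ (Fin N)) : 0 ≤ logProfile N a z y := by
  have := logWeight_pos (norm_nonneg (y - z))
  have h : 0 ≤ indicator (Icc (0 : ℝ) 1) (fun _ => (1 : ℝ)) ‖y - z‖ :=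
    indicator_nonneg (fun _ _ => zero_le_one) _
  unfold logProfile
  positivity

lemma logProfile_le (a : ℝ) (z y : EuclideanSpace ℝ (Fin N)) :
    logProfile N a z y ≤ ‖y - z‖ ^ (-(N : ℝ)) * logWeight ‖y - z‖ ^ (-a) := by
  have := logWeight_pos (norm_nonneg (y - z))
  refine mul_le_of_le_one_right (by positivity) ?_
  exact indicator_le' (fun _ _ => le_rfl) (fun _ _ => zero_le_one) _

lemma exists_lintegral_ball_logProfile_le (hN : 1 ≤ N) {a : ℝ} (ha : 1 < a) :
    ∃ C : ℝ, 0 ≤ C ∧ ∀ (z : EuclideanSpace ℝ (Fin N)) (ρ : ℝ), 0 < ρ →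
      ∫⁻ y in Metric.ball z ρ, ENNReal.ofReal (logProfile N a z y) ≤
        ENNReal.ofReal (C * logWeight ρ ^ (1 - a)) := by
  have ha' : 0 < a - 1 := by linarith
  set b := (1 + exp 1 * 1) / (a - 1) with hb
  refine ⟨N * volume.real (Metric.ball (0 : EuclideanSpace ℝ (Fin N)) 1) * b, by positivity,
    fun z ρ hρ => ?_⟩
  have key := lintegral_ball_radial hN (g := fun r => b * logWeight r ^ (1 - a))
    (φ := fun r => b * ((a - 1) * (r ^ (-(N : ℝ)) * logWeight r ^ (-a)) / (1 + exp 1 * r)))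
    hρ z ?_ ?_ ?_ ?_
  · rw [mul_assoc, ← key]
    refine setLIntegral_mono' measurableSet_ball fun y _ => ENNReal.ofReal_le_ofReal ?_
    have hL := logWeight_pos (norm_nonneg (y - z))
    by_cases h1 : ‖y - z‖ ≤ 1
    · exact (logProfile_le a z y).trans
        (le_mul_div_of_le (by positivity) (norm_nonneg _) h1 ha)
    · have : logProfile N a z y = 0 := by
        simp [logProfile, h1]
      rw [this]
      positivity
  · intro r hr
    refine ((hasDerivAt_logWeight_rpow hr.1 a).const_mul b).congr_deriv ?_
    have : r ^ (N - 1) * r ^ (-(N : ℝ)) = r⁻¹ := by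
      rw [← rpow_natCast, ← rpow_add hr.1, ← rpow_neg_one]
      push_cast [Nat.cast_sub hN]
      congr 1
      ring
    rw [← this]
    ring
  · intro r hr
    have := logWeight_pos hr
    positivity
  · exact (hasDerivAt_logWeight_rpow hρ a).continuousAt.const_mul b
  · simpa using (tendsto_logWeight_rpow ha).const_mul b

/-- The size of a logarithmic profile outside a ball centred at its pole. -/
lemma exists_logProfile_le_of_le (hN : 1 ≤ N) {a : ℝ} (ha : 0 < a) :
    ∃ C : ℝ, 1 ≤ C ∧ ∀ (z y : EuclideanSpace ℝ (Fin N)) (t : ℝ), 0 < t →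
      y ∉ Metric.ball z √t →
        logProfile N a z y ≤ C * (t ^ (-(N : ℝ) / 2) * logWeight √t ^ (-a)) := by
  obtain ⟨C, hC, h⟩ := exists_rpow_mul_logWeight_le (n := N) (by positivity) ha
  refine ⟨C, hC, fun z y t ht hy => (logProfile_le a z y).trans ?_⟩
  rw [← sqrt_rpow ht.le]
  refine h _ _ (sqrt_pos.2 ht) ?_
  simpa [dist_eq_norm] using hy

lemma exists_heatFlow_logProfile_le (hN : 1 ≤ N) {a : ℝ} (ha : 1 < a) :
    ∃ C : ℝ, 0 < C ∧ ∀ (z x : EuclideanSpace ℝ (Fin N)) (t : ℝ), 0 < t →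
      heatFlow N t (fun y => ENNReal.ofReal (logProfile N a z y)) x ≤
        ENNReal.ofReal (C * (t ^ (-(N : ℝ) / 2) * logWeight √t ^ (1 - a))) := by
  obtain ⟨C₁, hC₁, h₁⟩ := exists_lintegral_ball_logProfile_le hN ha
  obtain ⟨C₂, hC₂, h₂⟩ := exists_logProfile_le_of_le hN (zero_lt_one.trans ha)
  refine ⟨C₁ + C₂, by linarith, fun z x t ht => ?_⟩
  have hL := one_le_logWeight (sqrt_nonneg t)
  refine (heatFlow_le_of_ball (ρ := √t) ht (fun y _ => heatKernel_le_rpow (x - y) ht)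
    (h₁ z √t (sqrt_pos.2 ht)) fun y hy => ENNReal.ofReal_le_ofReal (h₂ z y t ht hy)).trans ?_
  have hL0 : 0 < logWeight √t := by linarith
  rw [← ENNReal.ofReal_mul (by positivity), ← ENNReal.ofReal_add (by positivity) (by positivity)]
  refine ENNReal.ofReal_le_ofReal ?_
  have h3 : logWeight √t ^ (-a) ≤ logWeight √t ^ (1 - a) :=
    rpow_le_rpow_of_exponent_le hL (by linarith)
  calc _ ≤ t ^ (-(N : ℝ) / 2) * (C₁ * logWeight √t ^ (1 - a)) +
        C₂ * (t ^ (-(N : ℝ) / 2) * logWeight √t ^ (1 - a)) := by gcongr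
    _ = _ := by ring

/-- The heat flow of a logarithmic profile, away from the pole. -/
lemma exists_heatFlow_logProfile_le_of_far (hN : 1 ≤ N) {a : ℝ} (ha : 1 < a) :
    ∃ C : ℝ, 0 < C ∧ ∀ (z x : EuclideanSpace ℝ (Fin N)) (t r : ℝ), 0 < t → 0 < r →
      2 * r ≤ ‖x - z‖ →
      heatFlow N t (fun y => ENNReal.ofReal (logProfile N a z y)) x ≤
        ENNReal.ofReal (C * r ^ (-(N : ℝ))) := by
  obtain ⟨C₁, hC₁, h₁⟩ := exists_lintegral_ball_logProfile_le hN ha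
  obtain ⟨C₂, hC₂, h₂⟩ := exists_heatKernel_le_norm_rpow hN
  refine ⟨C₂ * C₁ + 1, by positivity, fun z x t r ht hr hx => ?_⟩
  have hL := logWeight_pos hr.le
  refine (heatFlow_le_of_ball (ρ := r) (A := C₂ * r ^ (-(N : ℝ)))
    (S := ENNReal.ofReal (r ^ (-(N : ℝ)))) ht (fun y hy => h₂ _ _ _ ht hr ?_)
    (h₁ z r hr) fun y hy => ENNReal.ofReal_le_ofReal ?_).trans ?_
  · rw [Metric.mem_ball, dist_eq_norm] at hy
    have := norm_add_le (x - y) (y - z)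
    rw [sub_add_sub_cancel] at this
    linarith
  · have hy' : r ≤ ‖y - z‖ := by simpa [dist_eq_norm] using hy
    refine (logProfile_le a z y).trans ?_
    calc _ ≤ ‖y - z‖ ^ (-(N : ℝ)) * 1 := by
          gcongr
          exact logWeight_rpow_neg_le_one (norm_nonneg _) (by linarith)
      _ ≤ _ := by
          rw [mul_one]
          exact rpow_le_rpow_of_nonpos hr hy' (by simp)
  · rw [← ENNReal.ofReal_mul (by positivity), ← ENNReal.ofReal_add (by positivity) (by positivity)]
    refine ENNReal.ofReal_le_ofReal ?_
    have h3 : logWeight r ^ (1 - a) ≤ 1 :=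
      rpow_le_one_of_one_le_of_nonpos (one_le_logWeight hr.le) (by linarith)
    calc _ ≤ C₂ * r ^ (-(N : ℝ)) * (C₁ * 1) + r ^ (-(N : ℝ)) := by gcongr
      _ = _ := by ring

lemma logProfile_le_logProfile {a b : ℝ} (hab : a ≤ b) (z y : EuclideanSpace ℝ (Fin N)) :
    logProfile N b z y ≤ logProfile N a z y := by
  unfold logProfile
  have h : 0 ≤ indicator (Icc (0 : ℝ) 1) (fun _ => (1 : ℝ)) ‖y - z‖ :=
    indicator_nonneg (fun _ _ => zero_le_one) _
  gcongr
  exact one_le_logWeight (norm_nonneg _)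

/-- Near the pole, a steeper logarithmic profile gains a factor. -/
lemma logProfile_le_mul_logProfile {a b ρ : ℝ} (hab : a ≤ b) {z y : EuclideanSpace ℝ (Fin N)}
    (hN : 1 ≤ N) (hy : ‖y - z‖ ≤ ρ) :
    logProfile N b z y ≤ logWeight ρ ^ (-(b - a)) * logProfile N a z y := by
  rcases (norm_nonneg (y - z)).eq_or_lt with h0 | h0
  · have : (-(N : ℝ)) ≠ 0 := by
      have : (0 : ℝ) < N := by positivity
      linarith
    simp [logProfile, ← h0, zero_rpow this]
  have hL : 0 < logWeight ‖y - z‖ := logWeight_pos h0.le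
  have hρ := h0.trans_le hy
  have key : logWeight ‖y - z‖ ^ (-b) ≤ logWeight ρ ^ (-(b - a)) * logWeight ‖y - z‖ ^ (-a) := by
    rw [show -b = -(b - a) + -a by ring, rpow_add hL]
    exact mul_le_mul_of_nonneg_right
      (rpow_le_rpow_of_nonpos (logWeight_pos hρ.le) (logWeight_anti h0 hy) (by linarith))
      (by positivity)
  have h : 0 ≤ indicator (Icc (0 : ℝ) 1) (fun _ => (1 : ℝ)) ‖y - z‖ :=
    indicator_nonneg (fun _ _ => zero_le_one) _
  calc logProfile N b z y ≤ ‖y - z‖ ^ (-(N : ℝ)) *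
        (logWeight ρ ^ (-(b - a)) * logWeight ‖y - z‖ ^ (-a)) *
          indicator (Icc (0 : ℝ) 1) (fun _ => (1 : ℝ)) ‖y - z‖ := by
        unfold logProfile
        gcongr
    _ = _ := by
        unfold logProfile
        ring

end Estimates

/-! ### The barrier -/

section Barrier

variable {N : ℕ}

/-- The steep profile, which dominates the singular part of the initial data. -/
noncomputable def steepProfile (N : ℕ) (z y : EuclideanSpace ℝ (Fin N)) : ℝ≥0∞ :=
  ENNReal.ofReal (logProfile N (N / 2 + 1) z y)

/-- The flat profile, an auxiliary more singular function. -/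
noncomputable def flatProfile (N : ℕ) (z y : EuclideanSpace ℝ (Fin N)) : ℝ≥0∞ :=
  ENNReal.ofReal (logProfile N (N / 4 + 1) z y)

/-- The singular part of the supersolution. -/
noncomputable def barrier (N : ℕ) (z y : EuclideanSpace ℝ (Fin N)) (s : ℝ) : ℝ≥0∞ :=
  heatFlow N s (steepProfile N z) y +
    ENNReal.ofReal (logWeight √s ^ (-((N : ℝ) / 4))) * heatFlow N s (flatProfile N z) y

lemma measurable_steepProfile (z : EuclideanSpace ℝ (Fin N)) : Measurable (steepProfile N z) :=
  (measurable_logProfile _ z).ennreal_ofReal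

lemma measurable_flatProfile (z : EuclideanSpace ℝ (Fin N)) : Measurable (flatProfile N z) :=
  (measurable_logProfile _ z).ennreal_ofReal

lemma barrier_le_two_mul (z y : EuclideanSpace ℝ (Fin N)) (s : ℝ) :
    barrier N z y s ≤ 2 * heatFlow N s (flatProfile N z) y := by
  rw [two_mul]
  unfold barrier
  gcongr
  · refine heatFlow_mono (fun w => ENNReal.ofReal_le_ofReal (logProfile_le_logProfile ?_ z w)) s y
    have : (0 : ℝ) ≤ N := N.cast_nonneg
    linarith
  · refine mul_le_of_le_one_left' ?_
    rw [ENNReal.ofReal_le_one]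
    exact logWeight_rpow_neg_le_one (sqrt_nonneg _) (by positivity)

lemma barrier_lt_top (hN : 1 ≤ N) (z y : EuclideanSpace ℝ (Fin N)) {s : ℝ} (hs : 0 < s) :
    barrier N z y s < ∞ := by
  have hN0 : (0 : ℝ) < N := by positivity
  obtain ⟨C, -, h⟩ := exists_heatFlow_logProfile_le hN (a := N / 4 + 1) (by linarith)
  exact (barrier_le_two_mul z y s).trans_lt
    (ENNReal.mul_lt_top (by simp) ((h z y s hs).trans_lt ENNReal.ofReal_lt_top))

lemma exists_barrier_le_of_far (hN : 1 ≤ N) :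
    ∃ C : ℝ, 0 < C ∧ ∀ (z y : EuclideanSpace ℝ (Fin N)) (s r : ℝ), 0 < s → 0 < r →
      2 * r ≤ ‖y - z‖ → barrier N z y s ≤ ENNReal.ofReal (C * r ^ (-(N : ℝ))) := by
  have hN0 : (0 : ℝ) < N := by positivity
  obtain ⟨C, hC, h⟩ := exists_heatFlow_logProfile_le_of_far hN (a := N / 4 + 1) (by linarith)
  refine ⟨2 * C, by positivity, fun z y s r hs hr hy => (barrier_le_two_mul z y s).trans ?_⟩
  rw [mul_assoc, ENNReal.ofReal_mul (by norm_num)]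
  simp only [ENNReal.ofReal_ofNat]
  gcongr
  exact h z y s r hs hr hy

/-- The part of the steep profile near its pole is controlled by the flat profile. -/
lemma heatFlow_steepProfile_le (hN : 1 ≤ N) (z y : EuclideanSpace ℝ (Fin N)) (s : ℝ) :
    heatFlow N s (steepProfile N z) y ≤
      heatFlow N s ((Metric.ball z √s)ᶜ.indicator (steepProfile N z)) y +
        ENNReal.ofReal (logWeight √s ^ (-((N : ℝ) / 4))) *
          heatFlow N s (flatProfile N z) y := by
  have hN0 : (0 : ℝ) < N := by positivity
  rw [← heatFlow_const_mul _ (measurable_flatProfile z), ← heatFlow_add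
    ((measurable_steepProfile z).indicator measurableSet_ball.compl)]
  refine heatFlow_mono (fun w => ?_) s y
  by_cases hw : w ∈ Metric.ball z √s
  · refine le_add_left ?_
    have hL : 0 < logWeight √s := logWeight_pos (sqrt_nonneg s)
    unfold steepProfile flatProfile
    rw [← ENNReal.ofReal_mul (by positivity)]
    refine ENNReal.ofReal_le_ofReal ?_
    have := logProfile_le_mul_logProfile (a := (N : ℝ) / 4 + 1) (b := N / 2 + 1) (ρ := √s)
      (by linarith) (z := z) (y := w) hN (by simpa [dist_eq_norm] using hw.le)
    rwa [show (N : ℝ) / 2 + 1 - (N / 4 + 1) = N / 4 by ring] at this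
  · rw [indicator_of_mem (show w ∈ (Metric.ball z √s)ᶜ from hw)]
    exact le_self_add

lemma rpow_one_add (X : ℝ≥0∞) {q : ℝ} (hq : 0 ≤ q) : X ^ (1 + q) = X * X ^ q := by
  rw [ENNReal.rpow_add_of_nonneg _ _ zero_le_one hq, ENNReal.rpow_one]

/-- The nonlinear term of the barrier is the heat flow of the two profiles, up to factors that
are integrable in time. -/
lemma exists_barrier_rpow_le (hN : 1 ≤ N) :
    ∃ C : ℝ, 0 < C ∧ ∀ (z y : EuclideanSpace ℝ (Fin N)) (s : ℝ), 0 < s →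
      barrier N z y s ^ (1 + 2 / (N : ℝ)) ≤ ENNReal.ofReal C *
        (ENNReal.ofReal (s⁻¹ * logWeight √s ^ (-(1 + 2 / (N : ℝ)))) *
            heatFlow N s (steepProfile N z) y +
          ENNReal.ofReal (s⁻¹ * logWeight √s ^ (-(1 + (N : ℝ) / 4))) *
            heatFlow N s (flatProfile N z) y) := by
  have hN0 : (0 : ℝ) < N := by positivity
  obtain ⟨C₁, hC₁, h₁⟩ := exists_logProfile_le_of_le hN (a := (N : ℝ) / 2 + 1) (by positivity)
  obtain ⟨C₂, hC₂, h₂⟩ := exists_heatFlow_logProfile_le hN (a := N / 4 + 1) (by linarith)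
  set q : ℝ := 2 / N with hq
  have hq0 : 0 < q := by positivity
  have hNq : (N : ℝ) * q = 2 := by rw [hq]; field_simp
  set K : ℝ := max (C₁ ^ q) (2 * (2 * C₂) ^ q) with hK
  have hK0 : 0 < K := lt_max_of_lt_left (by positivity)
  refine ⟨2 ^ q * K, by positivity, fun z y s hs => ?_⟩
  set l := logWeight √s with hl
  have hL : 0 < l := logWeight_pos (sqrt_nonneg s)
  set Y := heatFlow N s ((Metric.ball z √s)ᶜ.indicator (steepProfile N z)) y with hY
  set S := heatFlow N s (steepProfile N z) y with hS
  set H := heatFlow N s (flatProfile N z) y with hH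
  have hYS : Y ≤ S := heatFlow_mono (fun w => indicator_le_self _ _ _) s y
  have hYC : Y ≤ ENNReal.ofReal (C₁ * (s ^ (-(N : ℝ) / 2) * l ^ (-((N : ℝ) / 2 + 1)))) := by
    refine heatFlow_le_const (fun w => ?_) hs y
    by_cases hw : w ∈ (Metric.ball z √s)ᶜ
    · rw [indicator_of_mem hw]
      exact ENNReal.ofReal_le_ofReal (h₁ z w s hs hw)
    · rw [indicator_of_notMem hw]
      exact zero_le
  have hHC : H ≤ ENNReal.ofReal (C₂ * (s ^ (-(N : ℝ) / 2) * l ^ (1 - ((N : ℝ) / 4 + 1)))) :=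
    h₂ z y s hs
  have es : (s ^ (-(N : ℝ) / 2)) ^ q = s⁻¹ := by
    rw [← rpow_mul hs.le, ← rpow_neg_one]
    congr 1
    linear_combination (-1 / 2) * hNq
  have e2 : (2 * C₂ * (s ^ (-(N : ℝ) / 2) * l ^ (-((N : ℝ) / 2)))) ^ q =
      (2 * C₂) ^ q * (s⁻¹ * l ^ (-1 : ℝ)) := by
    rw [mul_rpow (x := 2 * C₂) (by positivity) (by positivity),
      mul_rpow (x := s ^ (-(N : ℝ) / 2)) (by positivity) (by positivity), es, ← rpow_mul hL.le,
      show -((N : ℝ) / 2) * q = -1 by linear_combination (-1 / 2) * hNq]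
  have hYp : Y ^ (1 + q) ≤ ENNReal.ofReal (K * (s⁻¹ * l ^ (-(1 + q)))) * S := by
    rw [rpow_one_add _ hq0.le, mul_comm]
    gcongr
    refine (ENNReal.rpow_le_rpow hYC hq0.le).trans ?_
    rw [ENNReal.ofReal_rpow_of_nonneg (by positivity) hq0.le]
    refine ENNReal.ofReal_le_ofReal ?_
    rw [mul_rpow (by positivity) (by positivity), mul_rpow (by positivity) (by positivity), es,
      ← rpow_mul hL.le,
      show -((N : ℝ) / 2 + 1) * q = -(1 + q) by linear_combination (-1 / 2) * hNq]
    gcongr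
    exact le_max_left _ _
  have hHp : (2 * (ENNReal.ofReal (l ^ (-((N : ℝ) / 4))) * H)) ^ (1 + q) ≤
      ENNReal.ofReal (K * (s⁻¹ * l ^ (-(1 + (N : ℝ) / 4)))) * H := by
    have hb : 2 * (ENNReal.ofReal (l ^ (-((N : ℝ) / 4))) * H) ≤
        ENNReal.ofReal (2 * C₂ * (s ^ (-(N : ℝ) / 2) * l ^ (-((N : ℝ) / 2)))) := by
      calc _ ≤ 2 * (ENNReal.ofReal (l ^ (-((N : ℝ) / 4))) *
            ENNReal.ofReal (C₂ * (s ^ (-(N : ℝ) / 2) * l ^ (1 - ((N : ℝ) / 4 + 1))))) := by gcongr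
        _ = _ := by
          rw [← ENNReal.ofReal_ofNat 2, ← ENNReal.ofReal_mul (by positivity),
            ← ENNReal.ofReal_mul (by positivity),
            show -((N : ℝ) / 2) = -((N : ℝ) / 4) + (1 - ((N : ℝ) / 4 + 1)) by ring, rpow_add hL]
          congr 1
          ring
    rw [rpow_one_add _ hq0.le]
    calc _ ≤ 2 * (ENNReal.ofReal (l ^ (-((N : ℝ) / 4))) * H) *
          ENNReal.ofReal ((2 * C₂ * (s ^ (-(N : ℝ) / 2) * l ^ (-((N : ℝ) / 2)))) ^ q) := by
          gcongr
          refine (ENNReal.rpow_le_rpow hb hq0.le).trans_eq ?_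
          rw [ENNReal.ofReal_rpow_of_nonneg (by positivity) hq0.le]
      _ = ENNReal.ofReal (2 * (2 * C₂) ^ q * (s⁻¹ * l ^ (-(1 + (N : ℝ) / 4)))) * H := by
          rw [show (2 : ℝ≥0∞) = ENNReal.ofReal 2 by simp, ← mul_assoc, mul_right_comm,
            ← ENNReal.ofReal_mul (by positivity), ← ENNReal.ofReal_mul (by positivity), e2,
            show -(1 + (N : ℝ) / 4) = -((N : ℝ) / 4) + -1 by ring, rpow_add hL]
          congr 2
          ring
      _ ≤ _ := by
          gcongr
          exact le_max_right _ _
  have hsum : barrier N z y s ≤ Y + 2 * (ENNReal.ofReal (l ^ (-((N : ℝ) / 4))) * H) := by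
    unfold barrier
    rw [two_mul, ← add_assoc]
    gcongr
    exact heatFlow_steepProfile_le hN z y s
  calc barrier N z y s ^ (1 + q)
      ≤ (Y + 2 * (ENNReal.ofReal (l ^ (-((N : ℝ) / 4))) * H)) ^ (1 + q) :=
        ENNReal.rpow_le_rpow hsum (by linarith)
    _ ≤ 2 ^ (1 + q - 1) * (Y ^ (1 + q) +
          (2 * (ENNReal.ofReal (l ^ (-((N : ℝ) / 4))) * H)) ^ (1 + q)) :=
        ENNReal.rpow_add_le_mul_rpow_add_rpow _ _ (by linarith)
    _ ≤ 2 ^ q * (ENNReal.ofReal (K * (s⁻¹ * l ^ (-(1 + q)))) * S +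
          ENNReal.ofReal (K * (s⁻¹ * l ^ (-(1 + (N : ℝ) / 4)))) * H) := by
        rw [add_sub_cancel_left]
        gcongr
    _ = _ := by
        rw [ENNReal.ofReal_mul hK0.le, ENNReal.ofReal_mul hK0.le,
          ENNReal.ofReal_mul (p := 2 ^ q) (by positivity),
          ← ENNReal.ofReal_rpow_of_nonneg (by norm_num) hq0.le, ENNReal.ofReal_ofNat]
        ring

end Barrier

section Supersolution

variable {N : ℕ} {γ : ℝ}

/-- Separation of the singularities of the potential and of the barrier. -/
lemma exists_potential_mul_barrier_rpow_le (hN : 1 ≤ N) (hγ0 : 0 < γ) :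
    ∃ C : ℝ, 0 < C ∧ ∀ (z y : EuclideanSpace ℝ (Fin N)) (s B : ℝ), z ≠ 0 → 0 < s → 0 ≤ B →
      ENNReal.ofReal (‖y‖ ^ (-γ)) *
          (ENNReal.ofReal B * barrier N z y s) ^ (1 + 2 / (N : ℝ)) ≤
        ENNReal.ofReal (C * (B ^ (1 + 2 / (N : ℝ)) * ‖z‖ ^ (-γ))) *
            (ENNReal.ofReal (s⁻¹ * logWeight √s ^ (-(1 + 2 / (N : ℝ)))) *
              heatFlow N s (steepProfile N z) y +
            ENNReal.ofReal (s⁻¹ * logWeight √s ^ (-(1 + (N : ℝ) / 4))) *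
              heatFlow N s (flatProfile N z) y) +
          ENNReal.ofReal (C * (B * ‖z‖ ^ (-(N : ℝ))) ^ (1 + 2 / (N : ℝ))) *
            ENNReal.ofReal (‖y‖ ^ (-γ)) := by
  have hN0 : (0 : ℝ) < N := by positivity
  obtain ⟨C₁, hC₁, h₁⟩ := exists_barrier_rpow_le hN
  obtain ⟨C₂, hC₂, h₂⟩ := exists_barrier_le_of_far hN
  have hp : 0 < 1 + 2 / (N : ℝ) := by positivity
  set p : ℝ := 1 + 2 / (N : ℝ)
  have k₁ : 0 < 2 ^ γ * C₁ := by positivity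
  have k₂ : 0 < (C₂ * 4 ^ (N : ℝ)) ^ p := by positivity
  refine ⟨2 ^ γ * C₁ + (C₂ * 4 ^ (N : ℝ)) ^ p, by positivity, fun z y s B hz hs hB => ?_⟩
  have hz0 : 0 < ‖z‖ := norm_pos_iff.2 hz
  rcases le_or_gt (‖z‖ / 2) ‖y‖ with hy | hy
  · refine le_add_right ?_
    have hV : ‖y‖ ^ (-γ) ≤ 2 ^ γ * ‖z‖ ^ (-γ) := by
      refine (rpow_le_rpow_of_nonpos (by positivity) hy (by linarith)).trans_eq ?_
      rw [div_rpow hz0.le (by norm_num), rpow_neg (by norm_num : (0 : ℝ) ≤ 2), div_inv_eq_mul,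
        mul_comm]
    calc _ ≤ ENNReal.ofReal (2 ^ γ * ‖z‖ ^ (-γ)) * (ENNReal.ofReal (B ^ p) *
          (ENNReal.ofReal C₁ * _)) := by
          rw [ENNReal.mul_rpow_of_nonneg _ _ hp.le, ENNReal.ofReal_rpow_of_nonneg hB hp.le]
          gcongr
          exact h₁ z y s hs
      _ ≤ _ := by
          rw [← mul_assoc, ← mul_assoc, ← ENNReal.ofReal_mul (by positivity),
            ← ENNReal.ofReal_mul (by positivity)]
          gcongr ENNReal.ofReal ?_ * _
          have : 0 ≤ B ^ p * ‖z‖ ^ (-γ) := by positivity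
          linear_combination mul_nonneg k₂.le this
  · refine le_add_left ?_
    rw [mul_comm]
    gcongr
    have hr : 0 < ‖z‖ / 4 := by positivity
    have hfar : 2 * (‖z‖ / 4) ≤ ‖y - z‖ := by
      have := norm_sub_norm_le z y
      rw [norm_sub_rev] at this
      linarith
    have e : (‖z‖ / 4) ^ (-(N : ℝ)) = 4 ^ (N : ℝ) * ‖z‖ ^ (-(N : ℝ)) := by
      rw [div_rpow hz0.le (by norm_num), rpow_neg (by norm_num : (0 : ℝ) ≤ 4), div_inv_eq_mul,
        mul_comm]
    calc _ ≤ (ENNReal.ofReal B * ENNReal.ofReal (C₂ * (‖z‖ / 4) ^ (-(N : ℝ)))) ^ p := by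
          gcongr
          exact h₂ z y s _ hs hr hfar
      _ = ENNReal.ofReal ((C₂ * 4 ^ (N : ℝ)) ^ p * (B * ‖z‖ ^ (-(N : ℝ))) ^ p) := by
          rw [← ENNReal.ofReal_mul hB, ENNReal.ofReal_rpow_of_nonneg (by positivity) hp.le, e,
            ← mul_rpow (by positivity) (by positivity)]
          congr 2
          ring
      _ ≤ _ := by
          refine ENNReal.ofReal_le_ofReal (mul_le_mul_of_nonneg_right ?_ (by positivity))
          linarith

/-- The Duhamel integral of the sum of a multiple of the barrier and a constant. -/
lemma exists_duhamel_barrier_le (hN : 1 ≤ N) (hγ0 : 0 < γ) (hγ : γ < N) (hγ2 : γ < 2) :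
    ∃ C : ℝ, 0 < C ∧ ∀ (z x : EuclideanSpace ℝ (Fin N)) (t B M : ℝ), z ≠ 0 → 0 < t → 0 ≤ B →
      0 ≤ M →
      duhamel N γ (1 + 2 / (N : ℝ))
          (fun y s => ENNReal.ofReal B * barrier N z y s + ENNReal.ofReal M) x t ≤
        ENNReal.ofReal (C * (B ^ (1 + 2 / (N : ℝ)) * ‖z‖ ^ (-γ) * (1 + √t))) *
            barrier N z x t +
          ENNReal.ofReal (C * (((B * ‖z‖ ^ (-(N : ℝ))) ^ (1 + 2 / (N : ℝ)) +
            M ^ (1 + 2 / (N : ℝ))) * t ^ (1 - γ / 2))) := by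
  have hN0 : (0 : ℝ) < N := by positivity
  have hp : 1 ≤ 1 + 2 / (N : ℝ) := by
    have : 0 < 2 / (N : ℝ) := by positivity
    linarith
  have ha₁ : 1 < 1 + 2 / (N : ℝ) := by
    have : 0 < 2 / (N : ℝ) := by positivity
    linarith
  obtain ⟨C₀, hC₀, h₀⟩ := exists_potential_mul_barrier_rpow_le hN hγ0
  obtain ⟨C₁, hC₁, h₁⟩ := exists_lintegral_logWeight_sqrt_le ha₁
  obtain ⟨C₂, hC₂, h₂⟩ := exists_lintegral_logWeight_sqrt_le (a := 1 + (N : ℝ) / 4) (by linarith)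
  obtain ⟨C₃, hC₃, h₃⟩ := exists_lintegral_heatFlow_potential_le hN hγ0 hγ hγ2
  set p : ℝ := 1 + 2 / (N : ℝ)
  set K := 2 ^ (p - 1) * (C₀ + 1) * (C₁ + C₂ + C₃)
  refine ⟨K, by positivity, fun z x t B M hz ht hB hM => ?_⟩
  set κ₁ := 2 ^ (p - 1) * (C₀ * (B ^ p * ‖z‖ ^ (-γ))) with hκ₁
  set κ₂ := 2 ^ (p - 1) * (C₀ * (B * ‖z‖ ^ (-(N : ℝ))) ^ p + M ^ p) with hκ₂
  have hκ₁0 : 0 ≤ κ₁ := by positivity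
  have hκ₂0 : 0 ≤ κ₂ := by positivity
  set V : EuclideanSpace ℝ (Fin N) → ℝ≥0∞ := fun y => ENNReal.ofReal (‖y‖ ^ (-γ)) with hV
  have hVm : Measurable V := measurable_potential γ
  set b₁ : ℝ → ℝ≥0∞ := fun s => ENNReal.ofReal (s⁻¹ * logWeight √s ^ (-p)) with hb₁
  set b₂ : ℝ → ℝ≥0∞ := fun s => ENNReal.ofReal (s⁻¹ * logWeight √s ^ (-(1 + (N : ℝ) / 4))) with hb₂
  have hlw : Measurable fun s => logWeight √s := measurable_logWeight.comp (by fun_prop)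
  have hb₁m : Measurable b₁ := (measurable_inv.mul (hlw.pow_const _)).ennreal_ofReal
  have hb₂m : Measurable b₂ := (measurable_inv.mul (hlw.pow_const _)).ennreal_ofReal
  set S := heatFlow N t (steepProfile N z) x with hS
  set H := heatFlow N t (flatProfile N z) x with hH
  have hflow : ∀ {f : EuclideanSpace ℝ (Fin N) → ℝ≥0∞}, Measurable f → ∀ s : ℝ,
      Measurable (heatFlow N s f) := fun hf s =>
    (measurable_heatFlow hf).comp (f := fun y => (y, s)) (by fun_prop)
  have hpt : ∀ s ∈ Ioo 0 t, heatFlow N (t - s) (fun y => V y *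
      (ENNReal.ofReal B * barrier N z y s + ENNReal.ofReal M) ^ p) x ≤
      ENNReal.ofReal κ₁ * (b₁ s * S + b₂ s * H) + ENNReal.ofReal κ₂ * heatFlow N (t - s) V x := by
    intro s hs
    have hm₁ := (hflow (measurable_steepProfile z) s).const_mul (b₁ s)
    have hm₂ := (hflow (measurable_flatProfile z) s).const_mul (b₂ s)
    have hm₁₂ : Measurable fun y => b₁ s * heatFlow N s (steepProfile N z) y +
        b₂ s * heatFlow N s (flatProfile N z) y := hm₁.add hm₂
    calc _ ≤ heatFlow N (t - s) (fun y => ENNReal.ofReal κ₁ *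
          (b₁ s * heatFlow N s (steepProfile N z) y + b₂ s * heatFlow N s (flatProfile N z) y) +
            ENNReal.ofReal κ₂ * V y) x := by
          refine heatFlow_mono (fun y => ?_) _ _
          calc _ ≤ V y * (2 ^ (p - 1) * ((ENNReal.ofReal B * barrier N z y s) ^ p +
                ENNReal.ofReal M ^ p)) := by
                gcongr
                exact ENNReal.rpow_add_le_mul_rpow_add_rpow _ _ hp
            _ = 2 ^ (p - 1) * (V y * (ENNReal.ofReal B * barrier N z y s) ^ p +
                ENNReal.ofReal (M ^ p) * V y) := by
                rw [ENNReal.ofReal_rpow_of_nonneg hM (by linarith)]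
                ring
            _ ≤ 2 ^ (p - 1) * ((ENNReal.ofReal (C₀ * (B ^ p * ‖z‖ ^ (-γ))) *
                (b₁ s * heatFlow N s (steepProfile N z) y +
                  b₂ s * heatFlow N s (flatProfile N z) y) +
                ENNReal.ofReal (C₀ * (B * ‖z‖ ^ (-(N : ℝ))) ^ p) * V y) +
                ENNReal.ofReal (M ^ p) * V y) := by
                gcongr
                exact h₀ z y s B hz hs.1 hB
            _ = _ := by
                rw [hκ₁, hκ₂, ENNReal.ofReal_mul (p := 2 ^ (p - 1)) (by positivity),
                  ENNReal.ofReal_mul (p := 2 ^ (p - 1)) (by positivity),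
                  ENNReal.ofReal_add (by positivity) (by positivity),
                  ← ENNReal.ofReal_rpow_of_nonneg (x := 2) (by norm_num) (by linarith),
                  ENNReal.ofReal_ofNat]
                ring
      _ = _ := by
          rw [heatFlow_add (hm₁₂.const_mul _), heatFlow_const_mul _ hVm,
            heatFlow_const_mul _ hm₁₂, heatFlow_add hm₁,
            heatFlow_const_mul _ (hflow (measurable_steepProfile z) s),
            heatFlow_const_mul _ (hflow (measurable_flatProfile z) s),
            heatFlow_heatFlow (measurable_steepProfile z) hs.1 (sub_pos.2 hs.2),
            heatFlow_heatFlow (measurable_flatProfile z) hs.1 (sub_pos.2 hs.2), sub_add_cancel]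
  have hb₁₂ : Measurable fun s => b₁ s * S + b₂ s * H := (hb₁m.mul_const S).add (hb₂m.mul_const H)
  have hsq := sqrt_nonneg t
  have hL : 0 < logWeight √t := logWeight_pos hsq
  have i₁ : ∫⁻ s in Ioo 0 t, b₁ s ≤ ENNReal.ofReal ((C₁ + C₂ + C₃) * (1 + √t)) := by
    refine (h₁ t ht).trans (ENNReal.ofReal_le_ofReal ?_)
    calc _ ≤ C₁ * (1 + √t) * 1 := by
          gcongr
          exact rpow_le_one_of_one_le_of_nonpos (one_le_logWeight hsq) (by linarith)
      _ ≤ _ := by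
          rw [mul_one]
          gcongr
          linarith
  have i₂ : ∫⁻ s in Ioo 0 t, b₂ s ≤ ENNReal.ofReal ((C₁ + C₂ + C₃) * (1 + √t)) *
      ENNReal.ofReal (logWeight √t ^ (-((N : ℝ) / 4))) := by
    refine (h₂ t ht).trans ?_
    rw [← ENNReal.ofReal_mul (by positivity)]
    refine ENNReal.ofReal_le_ofReal ?_
    rw [show 1 - (1 + (N : ℝ) / 4) = -((N : ℝ) / 4) by ring]
    gcongr
    linarith
  calc _ ≤ ∫⁻ s in Ioo 0 t, (ENNReal.ofReal κ₁ * (b₁ s * S + b₂ s * H) +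
        ENNReal.ofReal κ₂ * heatFlow N (t - s) V x) := setLIntegral_mono' measurableSet_Ioo hpt
    _ = ENNReal.ofReal κ₁ * ((∫⁻ s in Ioo 0 t, b₁ s) * S + (∫⁻ s in Ioo 0 t, b₂ s) * H) +
        ENNReal.ofReal κ₂ * ∫⁻ s in Ioo 0 t, heatFlow N (t - s) V x := by
        rw [lintegral_add_left (hb₁₂.const_mul _),
          lintegral_const_mul' _ _ ENNReal.ofReal_ne_top,
          lintegral_const_mul' _ _ ENNReal.ofReal_ne_top, lintegral_add_left (hb₁m.mul_const S),
          lintegral_mul_const _ hb₁m, lintegral_mul_const _ hb₂m]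
    _ ≤ ENNReal.ofReal κ₁ * (ENNReal.ofReal ((C₁ + C₂ + C₃) * (1 + √t)) * S +
          ENNReal.ofReal ((C₁ + C₂ + C₃) * (1 + √t)) *
            ENNReal.ofReal (logWeight √t ^ (-((N : ℝ) / 4))) * H) +
        ENNReal.ofReal κ₂ * ENNReal.ofReal (C₃ * t ^ (1 - γ / 2)) := by
        gcongr
        exact h₃ t x ht
    _ = ENNReal.ofReal (κ₁ * ((C₁ + C₂ + C₃) * (1 + √t))) * barrier N z x t +
        ENNReal.ofReal (κ₂ * (C₃ * t ^ (1 - γ / 2))) := by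
        rw [ENNReal.ofReal_mul hκ₁0, ENNReal.ofReal_mul hκ₂0, barrier]
        ring
    _ ≤ _ := by
        have hA : 0 ≤ (2 : ℝ) ^ (p - 1) := by positivity
        gcongr ENNReal.ofReal ?_ * _ + ENNReal.ofReal ?_
        · have : 0 ≤ 2 ^ (p - 1) * (C₁ + C₂ + C₃) * (B ^ p * ‖z‖ ^ (-γ) * (1 + √t)) := by
            positivity
          rw [hκ₁]
          linear_combination this
        · rw [hκ₂]
          set m := (B * ‖z‖ ^ (-(N : ℝ))) ^ p
          have hm : 0 ≤ m := by positivity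
          have hMp : 0 ≤ M ^ p := by positivity
          calc _ ≤ 2 ^ (p - 1) * ((C₀ + 1) * (m + M ^ p)) *
                ((C₁ + C₂ + C₃) * t ^ (1 - γ / 2)) := by
                gcongr
                · nlinarith
                · linarith
            _ = _ := by ring

end Supersolution

section InitialData

variable {N : ℕ}

lemma heatFlow_initial_le (hN : 1 ≤ N) {z : EuclideanSpace ℝ (Fin N)}
    {u₀ : EuclideanSpace ℝ (Fin N) → ℝ} {B C : ℝ} (hB : 0 ≤ B) (hC : 0 ≤ C)
    (h : ∀ x, x ≠ z → u₀ x ≤ B * logProfile N (N / 2 + 1) z x + C) {t : ℝ} (ht : 0 < t)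
    (x : EuclideanSpace ℝ (Fin N)) :
    heatFlow N t (fun y => ENNReal.ofReal (u₀ y)) x ≤
      ENNReal.ofReal B * barrier N z x t + ENNReal.ofReal C := by
  have : Nonempty (Fin N) := ⟨⟨0, hN⟩⟩
  have hae : ∀ᵐ y : EuclideanSpace ℝ (Fin N), y ≠ z := by
    simp [ae_iff]
  calc _ ≤ heatFlow N t (fun y => ENNReal.ofReal B * steepProfile N z y + ENNReal.ofReal C) x := by
        refine heatFlow_mono_ae ?_ t x
        filter_upwards [hae] with y hy
        rw [steepProfile, ← ENNReal.ofReal_mul hB,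
          ← ENNReal.ofReal_add (mul_nonneg hB (logProfile_nonneg _ z y)) hC]
        exact ENNReal.ofReal_le_ofReal (h y hy)
    _ = ENNReal.ofReal B * heatFlow N t (steepProfile N z) x + ENNReal.ofReal C := by
        rw [heatFlow_add ((measurable_steepProfile z).const_mul _),
          heatFlow_const_mul _ (measurable_steepProfile z), heatFlow_const _ ht]
    _ ≤ _ := by
        gcongr
        exact le_self_add

end InitialData

theorem statement19 (N : ℕ) (hN : 1 ≤ N) (γ p : ℝ)
    (hγ0 : 0 < γ) (hγ : γ < min 2 (N : ℝ)) (hp : p = 1 + 2 / (N : ℝ)) :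
    ∃ cstar Cstar : ℝ, 0 < cstar ∧ 0 < Cstar ∧
      ∀ (T : ℝ), 0 < T →
      ∀ (z : EuclideanSpace ℝ (Fin N)), z ≠ 0 → T ≤ ‖z‖ ^ 2 →
      ∀ (u₀ : EuclideanSpace ℝ (Fin N) → ℝ) (c C₀ : ℝ),
        Measurable u₀ → (∀ x, 0 ≤ u₀ x) →
        0 < c → c ≤ cstar * (1 + T ^ ((1 : ℝ) / 2)) ^ (-1 / (p - 1)) →
        0 ≤ C₀ → C₀ ≤ Cstar * T ^ (-(2 - γ) / (2 * (p - 1))) →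
        (∀ x, x ≠ z →
          u₀ x ≤ c * ‖z‖ ^ (γ / (p - 1)) *
              (‖x - z‖ ^ (-(N : ℝ)) *
                Real.log (Real.exp 1 + ‖x - z‖⁻¹) ^ (-(N : ℝ) / 2 - 1) *
                Set.indicator (Set.Icc (0 : ℝ) 1) (fun _ => (1 : ℝ)) ‖x - z‖) + C₀) →
        ∃ u, IsSol N γ p T u₀ u := by
  have hN0 : (0 : ℝ) < N := by positivity
  obtain ⟨hγ2, hγN⟩ := lt_min_iff.1 hγ
  obtain ⟨K, hK, hduh⟩ := exists_duhamel_barrier_le hN hγ0 hγN hγ2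
  have hq : 0 < 2 / (N : ℝ) := by positivity
  have hq' : (N : ℝ) / 2 * (2 / N) = 1 := by field_simp
  set q : ℝ := 2 / (N : ℝ) with hq_def
  have hp1 : p - 1 = q := by rw [hp]; ring
  have hp0 : 0 < p := by linarith
  rw [← hp] at hduh
  have e₁ : -1 / (p - 1) = -((N : ℝ) / 2) := by
    rw [hp1, hq_def]
    field_simp
  have e₂ : γ / (p - 1) = γ * (N / 2) := by
    rw [hp1, hq_def]
    field_simp
  have e₃ : -(2 - γ) / (2 * (p - 1)) = -((2 - γ) * (N / 4)) := by
    rw [hp1, hq_def]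
    field_simp
    ring
  have hpow : ∀ a : ℝ, 0 < a → a ^ p = a ^ q * a := fun a ha => by
    rw [hp, add_comm, rpow_add_one ha.ne']
  set L : ℝ := 4 * K * 2 ^ p with hL
  have hL0 : 0 < L := by positivity
  set δ : ℝ := L ^ (-((N : ℝ) / 2)) with hδ
  have hδ0 : 0 < δ := by positivity
  have hδq : L * δ ^ q = 1 := by
    rw [hδ, ← rpow_mul hL0.le, neg_mul, hq', rpow_neg_one, mul_inv_cancel₀ hL0.ne']
  refine ⟨δ, δ / 2, hδ0, by positivity, ?_⟩
  rw [e₁, e₂, e₃]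
  intro T hT z hz hTz u₀ c C₀ hu₀ hu₀' hc hcδ hC₀ hC₀m hle
  rw [← sqrt_eq_rpow] at hcδ
  have hz0 : 0 < ‖z‖ := norm_pos_iff.2 hz
  have hsT := sqrt_nonneg T
  set m : ℝ := T ^ (-((2 - γ) * (N / 4))) with hm
  have hm0 : 0 < m := by positivity
  have hmq : m ^ q * T ^ (1 - γ / 2) = 1 := by
    rw [hm, ← rpow_mul hT.le, ← rpow_add hT]
    convert rpow_zero T using 2
    linear_combination -(1 - γ / 2) * hq'
  set B₀ : ℝ := c * ‖z‖ ^ (γ * (N / 2)) with hB₀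
  have hB₀0 : 0 < B₀ := by positivity
  have hcq : c ^ q * (1 + √T) ≤ δ ^ q := by
    calc _ ≤ (δ * (1 + √T) ^ (-((N : ℝ) / 2))) ^ q * (1 + √T) := by gcongr
      _ = δ ^ q := by
        rw [mul_rpow hδ0.le (by positivity), ← rpow_mul (x := 1 + √T) (by positivity), neg_mul, hq',
          rpow_neg_one, inv_mul_cancel_right₀ (by positivity)]
  have hcδ' : c ≤ δ := hcδ.trans <| mul_le_of_le_one_right hδ0.le <|
    rpow_le_one_of_one_le_of_nonpos (by linarith) (by linarith)
  have hB₀p : B₀ ^ p * ‖z‖ ^ (-γ) = c ^ q * B₀ := by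
    have : (‖z‖ ^ (γ * ((N : ℝ) / 2))) ^ q * ‖z‖ ^ (-γ) = 1 := by
      rw [← rpow_mul hz0.le, mul_assoc, hq', mul_one, ← rpow_add hz0, add_neg_cancel, rpow_zero]
    rw [hpow _ hB₀0]
    nth_rw 1 [hB₀]
    rw [mul_rpow hc.le (by positivity)]
    linear_combination (c ^ q * B₀) * this
  have hfar : 2 * B₀ * ‖z‖ ^ (-(N : ℝ)) ≤ 2 * (δ * m) := by
    have hzm : ‖z‖ ^ (γ * ((N : ℝ) / 2)) * ‖z‖ ^ (-(N : ℝ)) ≤ m := by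
      calc _ = (‖z‖ ^ 2) ^ (-((2 - γ) * ((N : ℝ) / 4))) := by
            rw [← rpow_add hz0, ← rpow_natCast, ← rpow_mul hz0.le]
            congr 1
            push_cast
            ring
        _ ≤ m := rpow_le_rpow_of_nonpos hT hTz
            (neg_nonpos.2 (mul_nonneg (by linarith) (by positivity)))
    calc _ = 2 * (c * (‖z‖ ^ (γ * ((N : ℝ) / 2)) * ‖z‖ ^ (-(N : ℝ)))) := by rw [hB₀]; ring
      _ ≤ _ := by gcongr
  refine exists_isSol_of_supersolution hp0 hu₀ hu₀'
    (w := fun x t => ENNReal.ofReal (2 * B₀) * barrier N z x t + ENNReal.ofReal (δ * m))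
    (fun x t ht => ENNReal.add_lt_top.2
      ⟨ENNReal.mul_lt_top ENNReal.ofReal_lt_top (barrier_lt_top hN z x ht.1),
        ENNReal.ofReal_lt_top⟩) fun x t ht => ?_
  have hS := heatFlow_initial_le hN (u₀ := u₀) hB₀0.le hC₀ (fun y hy => by
    have := hle y hy
    rwa [show -(N : ℝ) / 2 - 1 = -(N / 2 + 1) by ring] at this) ht.1 x
  have hD := hduh z x t (2 * B₀) (δ * m) hz ht.1 (by positivity) (by positivity)
  have hsing : K * ((2 * B₀) ^ p * ‖z‖ ^ (-γ) * (1 + √t)) ≤ B₀ := by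
    calc _ = K * 2 ^ p * (c ^ q * (1 + √t)) * B₀ := by
          rw [mul_rpow (by norm_num) hB₀0.le]
          linear_combination K * 2 ^ p * (1 + √t) * hB₀p
      _ ≤ K * 2 ^ p * (c ^ q * (1 + √T)) * B₀ := by
          gcongr
          exact ht.2.le
      _ ≤ K * 2 ^ p * δ ^ q * B₀ := by gcongr
      _ ≤ B₀ := by
          refine mul_le_of_le_one_left hB₀0.le ?_
          linarith
  have hconst : K * (((2 * B₀ * ‖z‖ ^ (-(N : ℝ))) ^ p + (δ * m) ^ p) * t ^ (1 - γ / 2)) ≤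
      δ * m / 2 := by
    calc _ ≤ K * (((2 * (δ * m)) ^ p + (2 * (δ * m)) ^ p) * T ^ (1 - γ / 2)) := by
          have h1 : δ * m ≤ 2 * (δ * m) := by linarith [mul_pos hδ0 hm0]
          have h2 : 0 ≤ 1 - γ / 2 := by linarith
          have h3 := ht.1.le
          have h4 := ht.2.le
          gcongr
      _ = L * δ ^ q * (m ^ q * T ^ (1 - γ / 2)) * (δ * m) / 2 := by
          rw [mul_rpow (by norm_num) (by positivity), hpow (δ * m) (by positivity),
            mul_rpow hδ0.le hm0.le, hL]
          ring
      _ = _ := by rw [hδq, hmq]; ring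
  calc _ ≤ (ENNReal.ofReal B₀ * barrier N z x t + ENNReal.ofReal C₀) +
        (ENNReal.ofReal B₀ * barrier N z x t + ENNReal.ofReal (δ * m / 2)) := by
        refine add_le_add hS (hD.trans ?_)
        gcongr
    _ = ENNReal.ofReal (2 * B₀) * barrier N z x t + ENNReal.ofReal (C₀ + δ * m / 2) := by
        rw [ENNReal.ofReal_add hC₀ (by positivity), two_mul,
          ENNReal.ofReal_add hB₀0.le hB₀0.le]
        ring
    _ ≤ _ := by
        gcongr
        linarith
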